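/- arXiv:1010.3667 — 2 statements merged into one kernel-verified Lean document; each statement's English description precedes it below -/
import Mathlib

section
/- The automorphisms of 𝔼_{1/2,2} are exactly the maps (z₁,z₂) ↦ (ζz₁, ζ²z₂) and the maps (z₁,z₂) ↦ (ζz₁, ζ²(z₁²/4 − z₂)), where ζ ∈ 𝕋. -/
open Finset

/-- The symmetrization map `π_n : ℂⁿ → ℂⁿ`, whose `k`-th component is the
`(k+1)`-st elementary symmetric polynomial of the coordinates. -/
noncomputable def piMap (n : ℕ) (z : Fin n → ℂ) : Fin n → ℂ :=
  fun k => ∑ s ∈ Finset.powersetCard (k.1 + 1) Finset.univ, ∏ j ∈ s, z j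

/-- The generalized complex ellipsoid `𝔹_{p,n} = {z : ∑ |z_j|^(2p) < 1}`. -/
noncomputable def ellipsoid (p : ℝ) (n : ℕ) : Set (Fin n → ℂ) :=
  {z | ∑ j, ‖z j‖ ^ (2 * p) < 1}

/-- The symmetrized `(p,n)`-ellipsoid `𝔼_{p,n} = π_n(𝔹_{p,n})`. -/
noncomputable def symEllipsoid (p : ℝ) (n : ℕ) : Set (Fin n → ℂ) :=
  piMap n '' ellipsoid p n

/-- The Euclidean unit ball in `ℂⁿ`. -/
def unitBall (n : ℕ) : Set (Fin n → ℂ) :=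
  {z | ∑ j, ‖z j‖ ^ 2 < 1}

/-- `f` is a proper holomorphic map from the domain `D` onto (into) the domain `G`:
it is holomorphic on `D`, maps `D` into `G`, and preimages of compact subsets of `G`
are compact. -/
def IsProperHolomorphic {n : ℕ} (f : (Fin n → ℂ) → (Fin n → ℂ))
    (D G : Set (Fin n → ℂ)) : Prop :=
  DifferentiableOn ℂ f D ∧ Set.MapsTo f D G ∧
    ∀ K : Set (Fin n → ℂ), K ⊆ G → IsCompact K → IsCompact (D ∩ f ⁻¹' K)

/-- `φ` is an automorphism of the domain `D`: a holomorphic bijection of `D` onto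
itself with holomorphic inverse. -/
def IsAutomorphismOf {n : ℕ} (φ : (Fin n → ℂ) → (Fin n → ℂ))
    (D : Set (Fin n → ℂ)) : Prop :=
  DifferentiableOn ℂ φ D ∧ Set.BijOn φ D D ∧
    ∃ ψ : (Fin n → ℂ) → (Fin n → ℂ), DifferentiableOn ℂ ψ D ∧ Set.InvOn ψ φ D D

/-- `f : ℂⁿ → ℂⁿ` is a polynomial mapping. -/
def IsPolynomialMap {n : ℕ} (f : (Fin n → ℂ) → (Fin n → ℂ)) : Prop :=
  ∃ P : Fin n → MvPolynomial (Fin n) ℂ, ∀ z k, f z k = MvPolynomial.eval z (P k)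

section Helpers

open Set Metric Filter Topology MeasureTheory


lemma diff_fderiv {F : ℂ × ℂ → ℂ} {U : Set (ℂ × ℂ)} (hU : IsOpen U)
    (hF : DifferentiableOn ℂ F U) (v : ℂ × ℂ) :
    DifferentiableOn ℂ (fun z => fderiv ℂ F z v) U := by
  intro z0 hz0
  apply DifferentiableAt.differentiableWithinAt
  obtain ⟨R, hR, hRU⟩ := Metric.nhds_basis_closedBall.mem_iff.1 (hU.mem_nhds hz0)
  obtain ⟨C, hC⟩ := (isCompact_closedBall z0 R).exists_bound_of_continuousOn
    (hF.continuousOn.mono hRU)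
  set r := R / 4 with hr
  have hr0 : 0 < r := by positivity
  set ρ := r / (‖v‖ + 1) with hρ
  have hv1 : 0 < ‖v‖ + 1 := by positivity
  have hρ0 : 0 < ρ := by positivity
  have hρv : ρ * ‖v‖ ≤ r := by
    rw [hρ, div_mul_eq_mul_div, div_le_iff₀ hv1]
    nlinarith [norm_nonneg v]
  have hdiffAt : ∀ x ∈ closedBall z0 (2 * r), DifferentiableAt ℂ F x := fun x hx =>
    (hF x (hRU (closedBall_subset_closedBall (by linarith) hx))).differentiableAt
      (hU.mem_nhds (hRU (closedBall_subset_closedBall (by linarith) hx)))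
  have hbd : ∀ x ∈ closedBall z0 (2 * r), ‖fderiv ℂ F x‖ ≤ 2 * C / r := by
    intro x hx
    have hsub : ball x r ⊆ closedBall z0 R := by
      intro y hy
      rw [mem_closedBall] at *
      rw [mem_ball] at hy
      linarith [dist_triangle y x z0]
    refine Complex.norm_fderiv_le_div_of_mapsTo_ball (hF.mono (hsub.trans hRU)) ?_ hr0
    intro y hy
    rw [mem_closedBall, dist_eq_norm]
    have h1 := hC y (hsub hy)
    have h2 := hC x (hsub (mem_ball_self hr0))
    linarith [norm_sub_le (F y) (F x)]
  have hmem : ∀ z ∈ ball z0 r, ∀ t : ℂ, ‖t‖ ≤ ρ → z + t • v ∈ closedBall z0 (2 * r) := by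
    intro z hz t ht
    rw [mem_closedBall]
    rw [mem_ball] at hz
    have : dist (z + t • v) z ≤ r := by
      rw [dist_eq_norm, add_sub_cancel_left, norm_smul]
      exact le_trans (mul_le_mul_of_nonneg_right ht (norm_nonneg v)) hρv
    linarith [dist_triangle (z + t • v) z z0]
  have hcm : ∀ θ : ℝ, ‖circleMap 0 ρ θ‖ ≤ ρ := by
    intro θ; simp [abs_of_pos hρ0]
  have hA : ∀ z ∈ ball z0 r, fderiv ℂ F z v =
      (2 * Real.pi * Complex.I : ℂ)⁻¹ • ∫ θ in (0 : ℝ)..2 * Real.pi,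
        (deriv (circleMap 0 ρ) θ * ((circleMap 0 ρ θ) ^ 2)⁻¹) * F (z + circleMap 0 ρ θ • v) := by
    intro z hz
    have e1 : deriv (fun t : ℂ => F (z + t • v)) 0 = fderiv ℂ F z v := by
      have h1 : HasDerivAt (fun t : ℂ => z + t • v) v 0 := by
        simpa using ((hasDerivAt_id (0 : ℂ)).smul_const v).const_add z
      have h2 : HasFDerivAt F (fderiv ℂ F z) (z + (0 : ℂ) • v) := by
        simpa using (hdiffAt z (ball_subset_closedBall
          (ball_subset_ball (by linarith) hz))).hasFDerivAt
      exact (h2.comp_hasDerivAt (0 : ℂ) h1).deriv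
    have hO : IsOpen ((fun t : ℂ => z + t • v) ⁻¹' U) := hU.preimage (by fun_prop)
    rw [← e1, ← Complex.cderiv_eq_deriv hO (r := ρ) _ hρ0 _]
    · rw [Complex.cderiv, circleIntegral]
      simp [mul_assoc]
    · exact hF.comp (by fun_prop) (fun t ht => ht)
    · intro t ht
      exact hRU (closedBall_subset_closedBall (by linarith) (hmem z hz t (by simpa using ht)))
  have hB : HasFDerivAt (fun z => ∫ θ in (0 : ℝ)..2 * Real.pi,
        (deriv (circleMap 0 ρ) θ * ((circleMap 0 ρ θ) ^ 2)⁻¹) * F (z + circleMap 0 ρ θ • v))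
      (∫ θ in (0 : ℝ)..2 * Real.pi,
        (deriv (circleMap 0 ρ) θ * ((circleMap 0 ρ θ) ^ 2)⁻¹) •
          fderiv ℂ F (z0 + circleMap 0 ρ θ • v)) z0 := by
    have hk : Continuous (fun θ : ℝ => deriv (circleMap 0 ρ) θ * ((circleMap 0 ρ θ) ^ 2)⁻¹) := by
      have h0 : ∀ θ, circleMap 0 ρ θ ^ 2 ≠ 0 := fun θ => pow_ne_zero _ (circleMap_ne_center hρ0.ne')
      simp only [deriv_circleMap]
      have hc : Continuous (circleMap 0 ρ) := continuous_circleMap 0 ρ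
      exact (hc.mul continuous_const).mul ((hc.pow 2).inv₀ h0)
    have hcont : ∀ z ∈ ball z0 r, Continuous (fun θ : ℝ =>
        (deriv (circleMap 0 ρ) θ * ((circleMap 0 ρ θ) ^ 2)⁻¹) * F (z + circleMap 0 ρ θ • v)) := by
      intro z hz
      refine hk.mul ?_
      refine hF.continuousOn.comp_continuous (by fun_prop) ?_
      intro θ
      exact hRU (closedBall_subset_closedBall (by linarith) (hmem z hz _ (hcm θ)))
    refine intervalIntegral.hasFDerivAt_integral_of_dominated_of_fderiv_le (𝕜 := ℂ)
      (s := ball z0 r) (bound := fun θ =>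
        ‖deriv (circleMap 0 ρ) θ * ((circleMap 0 ρ θ) ^ 2)⁻¹‖ * (2 * C / r))
      (F' := fun z θ => (deriv (circleMap 0 ρ) θ * ((circleMap 0 ρ θ) ^ 2)⁻¹) •
          fderiv ℂ F (z + circleMap 0 ρ θ • v))
      (ball_mem_nhds z0 hr0) ?_ ?_ ?_ ?_ ?_ ?_
    · filter_upwards [ball_mem_nhds z0 hr0] with z hz
      exact (hcont z hz).aestronglyMeasurable
    · exact (hcont z0 (mem_ball_self hr0)).intervalIntegrable _ _
    · refine hk.aestronglyMeasurable.smul ?_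
      have hm : Measurable (fun θ : ℝ => fderiv ℂ F (z0 + circleMap 0 ρ θ • v)) := by
        refine (measurable_fderiv ℂ F).comp ?_
        exact Continuous.measurable (by fun_prop)
      exact hm.aestronglyMeasurable
    · refine Eventually.of_forall fun θ _ z hz => ?_
      rw [norm_smul]
      exact mul_le_mul_of_nonneg_left (hbd _ (hmem z hz _ (hcm θ))) (norm_nonneg _)
    · exact (hk.norm.mul continuous_const).intervalIntegrable _ _
    · refine Eventually.of_forall fun θ _ z hz => ?_
      have h1 := (hdiffAt _ (hmem z hz _ (hcm θ))).hasFDerivAt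
      have h2 : HasFDerivAt (fun z : ℂ × ℂ => z + circleMap 0 ρ θ • v)
        (ContinuousLinearMap.id ℂ (ℂ × ℂ)) z := (hasFDerivAt_id z).add_const _
      have h3 := (h1.comp z h2).const_mul (deriv (circleMap 0 ρ) θ * ((circleMap 0 ρ θ) ^ 2)⁻¹)
      simpa using h3
  have hB' := (hB.differentiableAt).const_smul ((2 * Real.pi * Complex.I : ℂ)⁻¹)
  refine hB'.congr_of_eventuallyEq ?_
  filter_upwards [ball_mem_nhds z0 hr0] with z hz
  exact hA z hz


lemma const_of_im_zero {h : ℂ → ℂ} (hd : DifferentiableOn ℂ h (ball 0 1))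
    (him : ∀ z ∈ ball (0 : ℂ) 1, (h z).im = 0) : ∃ k : ℝ, ∀ z ∈ ball (0 : ℂ) 1, h z = k := by
  have han : AnalyticOnNhd ℂ h (ball 0 1) := hd.analyticOnNhd isOpen_ball
  rcases han.is_constant_or_isOpen (convex_ball 0 1).isPreconnected with ⟨w, hw⟩ | hop
  · have h0 := hw 0 (by simp)
    refine ⟨w.re, fun z hz => ?_⟩
    apply Complex.ext
    · simp [hw z hz]
    · simpa using him z hz
  · exfalso
    have h1 := hop (ball 0 1) Subset.rfl isOpen_ball
    obtain ⟨ε, hε, hb⟩ := Metric.isOpen_iff.1 h1 (h 0) ⟨0, by simp, rfl⟩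
    have : h 0 + ((ε / 2 : ℝ) : ℂ) * Complex.I ∈ ball (h 0) ε := by
      rw [mem_ball, dist_eq_norm]
      simp [abs_of_pos hε, hε]
    obtain ⟨z, hz, hz2⟩ := hb this
    have h3 := him z hz
    rw [hz2] at h3
    have h4 := him 0 (by simp)
    simp [h4] at h3
    exact hε.ne' h3

lemma const_of_im_small {h : ℂ → ℂ} (hd : DifferentiableOn ℂ h (ball 0 1))
    (him : ∀ ε > 0, ∃ r < (1 : ℝ), ∀ z : ℂ, r ≤ ‖z‖ → ‖z‖ < 1 → |(h z).im| ≤ ε) :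
    ∃ k : ℝ, ∀ z ∈ ball (0 : ℂ) 1, h z = k := by
  apply const_of_im_zero hd
  intro z hz
  rw [mem_ball_zero_iff] at hz
  have key : ∀ ε > 0, |(h z).im| ≤ ε := by
    intro ε hε
    obtain ⟨r, hr, hb⟩ := him ε hε
    obtain ⟨ρ, hρ1, hρ2⟩ := exists_between (max_lt hr hz)
    have hzρ : ‖z‖ < ρ := lt_of_le_of_lt (le_max_right _ _) hρ1
    have hrρ : r < ρ := lt_of_le_of_lt (le_max_left _ _) hρ1
    have hρ0 : 0 < ρ := lt_of_le_of_lt (norm_nonneg z) hzρ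
    have hsub : closedBall (0 : ℂ) ρ ⊆ ball 0 1 := closedBall_subset_ball hρ2
    have main : ∀ c : ℂ, (∀ w, (c * h w).re = (h w).im) ∨ (∀ w, (c * h w).re = -(h w).im) →
        (c * h z).re ≤ ε := by
      intro c hc
      have hdc : DiffContOnCl ℂ (fun w => Complex.exp (c * h w)) (ball 0 ρ) := by
        apply DifferentiableOn.diffContOnCl
        rw [closure_ball _ hρ0.ne']
        exact ((hd.mono hsub).const_mul c).cexp
      have := Complex.norm_le_of_forall_mem_frontier_norm_le (C := Real.exp ε)
        isBounded_ball hdc ?_ (z := z) (subset_closure (by simpa using hzρ))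
      · rwa [Complex.norm_exp, Real.exp_le_exp] at this
      · intro w hw
        rw [frontier_ball _ hρ0.ne', mem_sphere_zero_iff_norm] at hw
        rw [Complex.norm_exp, Real.exp_le_exp]
        have h2 := abs_le.1 (hb w (by linarith) (by linarith))
        rcases hc with hc | hc <;> rw [hc w] <;> linarith
    rw [abs_le]
    constructor
    · have := main Complex.I (Or.inr (by simp))
      simp at this; linarith
    · have := main (-Complex.I) (Or.inl (by simp))
      simpa using this
  have : |(h z).im| ≤ 0 := le_of_forall_pos_le_add (by simpa using key)
  exact abs_nonpos_iff.1 this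

open ComplexConjugate in
lemma section_form {R : ℂ → ℂ} (hd : DifferentiableOn ℂ R (ball 0 1)) {C : ℝ}
    (hC : ∀ z ∈ ball (0 : ℂ) 1, ((R z * conj z ^ 2).im) ^ 2 ≤ C * (1 - ‖z‖ ^ 2)) :
    ∃ k : ℝ, ∀ z ∈ ball (0 : ℂ) 1, R z = R 0 + deriv R 0 * z + k * z ^ 2 +
      conj (deriv R 0) * z ^ 3 + conj (R 0) * z ^ 4 := by
  have hnh : ball (0 : ℂ) 1 ∈ 𝓝 (0 : ℂ) := ball_mem_nhds _ one_pos
  set d1 := dslope R 0 with hd1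
  set d2 := dslope d1 0 with hd2
  have hD1 : DifferentiableOn ℂ d1 (ball 0 1) := (Complex.differentiableOn_dslope hnh).2 hd
  have hD2 : DifferentiableOn ℂ d2 (ball 0 1) := (Complex.differentiableOn_dslope hnh).2 hD1
  have hR : ∀ z, R z = R 0 + deriv R 0 * z + d2 z * z ^ 2 := by
    intro z
    have e1 : z * d1 z = R z - R 0 := by simpa using sub_smul_dslope R 0 z
    have e2 : z * d2 z = d1 z - d1 0 := by simpa using sub_smul_dslope d1 0 z
    have e3 : d1 0 = deriv R 0 := dslope_same R 0
    rw [← e3]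
    linear_combination -e1 - z * e2
  set c0 := R 0 with hc0
  set c1 := deriv R 0 with hc1
  have hdh : DifferentiableOn ℂ (fun z => d2 z - conj c1 * z - conj c0 * z ^ 2) (ball 0 1) := by
    fun_prop
  obtain ⟨k, hk⟩ := const_of_im_small hdh (by
    intro ε hε
    have hcont : Continuous (fun r : ℝ => 16 * (√(C * (1 - r ^ 2)) +
      ‖c0‖ * (1 - r ^ 4) + ‖c1‖ * (r ^ 2 - r ^ 4))) := by fun_prop
    have ht := hcont.tendsto 1
    simp only [one_pow, sub_self, mul_zero, Real.sqrt_zero, add_zero] at ht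
    obtain ⟨δ, hδ, hb⟩ := Metric.eventually_nhds_iff.1 (ht.eventually (gt_mem_nhds hε))
    refine ⟨max (1 - δ / 2) (1 / 2), max_lt (by linarith) (by norm_num), ?_⟩
    intro z hz1 hz2
    have hz3 : 1 - δ / 2 ≤ ‖z‖ := le_trans (le_max_left _ _) hz1
    have hz4 : 1 / 2 ≤ ‖z‖ := le_trans (le_max_right _ _) hz1
    have hbz := hb (y := ‖z‖) (by rw [Real.dist_eq, abs_lt]; constructor <;> linarith)
    refine le_trans ?_ hbz.le
    have hzz : z * conj z = ((‖z‖ ^ 2 : ℝ) : ℂ) := by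
      rw [Complex.mul_conj, Complex.normSq_eq_norm_sq]
    have e : (d2 z - conj c1 * z - conj c0 * z ^ 2) * ((‖z‖ ^ 4 : ℝ) : ℂ) =
        R z * conj z ^ 2 - c0 * conj z ^ 2 - ((‖z‖ ^ 2 : ℝ) : ℂ) * (c1 * conj z)
        - ((‖z‖ ^ 4 : ℝ) : ℂ) * conj (c1 * conj z) - ((‖z‖ ^ 4 : ℝ) : ℂ) * conj (c0 * conj z ^ 2) := by
      have h4 : ((‖z‖ ^ 4 : ℝ) : ℂ) = (z * conj z) ^ 2 := by rw [hzz]; push_cast; ring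
      rw [h4, ← hzz, hR z]
      simp only [map_mul, map_pow, Complex.conj_conj]
      ring
    have e2 := congrArg Complex.im e
    simp only [Complex.sub_im, Complex.re_ofReal_mul, Complex.im_ofReal_mul, Complex.im_mul_ofReal,
      Complex.conj_im] at e2
    have a1 : |(R z * conj z ^ 2).im| ≤ √(C * (1 - ‖z‖ ^ 2)) := 
      Real.abs_le_sqrt (hC z (by simpa using hz2))
    have a2 : |(c0 * conj z ^ 2).im| ≤ ‖c0‖ := by
      refine (Complex.abs_im_le_norm _).trans ?_
      simp only [norm_mul, norm_pow, RCLike.norm_conj]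
      exact mul_le_of_le_one_right (norm_nonneg _) (pow_le_one₀ (norm_nonneg _) hz2.le)
    have a3 : |(c1 * conj z).im| ≤ ‖c1‖ := by
      refine (Complex.abs_im_le_norm _).trans ?_
      simp only [norm_mul, RCLike.norm_conj]
      exact mul_le_of_le_one_right (norm_nonneg _) hz2.le
    set r := ‖z‖
    set I0 := ((fun z => d2 z - conj c1 * z - conj c0 * z ^ 2) z).im with hI0
    have e3 : I0 * r ^ 4 = (R z * conj z ^ 2).im - (1 - r ^ 4) * (c0 * conj z ^ 2).im
        - (r ^ 2 - r ^ 4) * (c1 * conj z).im := by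
      simp only [hI0, Complex.sub_im]; linear_combination e2
    have r4 : 1 / 16 ≤ r ^ 4 := by
      have := pow_le_pow_left₀ (by norm_num) hz4 4
      norm_num at this ⊢; linarith
    have r2 : r ^ 2 ≤ 1 := pow_le_one₀ (norm_nonneg _) hz2.le
    have r41 : r ^ 4 ≤ 1 := pow_le_one₀ (norm_nonneg _) hz2.le
    have r42 : 0 ≤ r ^ 2 - r ^ 4 := by nlinarith [sq_nonneg r]
    have e4 : |I0| * r ^ 4 ≤ √(C * (1 - r ^ 2)) + ‖c0‖ * (1 - r ^ 4) + ‖c1‖ * (r ^ 2 - r ^ 4) := by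
      have : |I0| * r ^ 4 = |I0 * r ^ 4| := by rw [abs_mul, abs_of_nonneg (by positivity : 0 ≤ r ^ 4)]
      rw [this, e3]
      refine (abs_sub _ _).trans ?_
      refine add_le_add ((abs_sub _ _).trans (add_le_add a1 ?_)) ?_
      · rw [abs_mul, abs_of_nonneg (by linarith), mul_comm]
        exact mul_le_mul_of_nonneg_right a2 (by linarith)
      · rw [abs_mul, abs_of_nonneg r42, mul_comm]
        exact mul_le_mul_of_nonneg_right a3 r42
    nlinarith [abs_nonneg I0])
  refine ⟨k, fun z hz => ?_⟩
  have := hk z hz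
  rw [hR z]
  linear_combination z ^ 2 * this

open ComplexConjugate in
/-- a nonnegative section is controlled by its middle coefficient -/
lemma section_nonneg {R : ℂ → ℂ} (hd : DifferentiableOn ℂ R (ball 0 1)) {C : ℝ}
    (hC : ∀ z ∈ ball (0 : ℂ) 1, ((R z * conj z ^ 2).im) ^ 2 ≤ C * (1 - ‖z‖ ^ 2))
    (hpos : ∀ z ∈ ball (0 : ℂ) 1, -(C * (1 - ‖z‖ ^ 2)) ≤ (R z * conj z ^ 2).re) :
    ∃ k : ℝ, 0 ≤ k ∧ R (1 / 2) - R (Complex.I / 2) + R (-1 / 2) - R (-Complex.I / 2) = k ∧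
      ∀ z ∈ ball (0 : ℂ) 1, ‖R z‖ ≤ 5 * k := by
  obtain ⟨k, hk⟩ := section_form hd hC
  set c0 := R 0 with hc0
  set c1 := deriv R 0 with hc1
  have hT : ∀ w : ℂ, ‖w‖ = 1 → 0 ≤ k + 2 * (c1 * conj w).re + 2 * (c0 * conj w ^ 2).re := by
    intro w hw
    have hww : w * conj w = 1 := by
      rw [Complex.mul_conj, Complex.normSq_eq_norm_sq, hw]; simp
    have hcont : Continuous (fun r : ℝ => (((c0 + c1 * (r * w) + k * (r * w) ^ 2 +
      conj c1 * (r * w) ^ 3 + conj c0 * (r * w) ^ 4) * conj (r * w) ^ 2)).re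
        + C * (1 - r ^ 2)) := by fun_prop
    have ht := (hcont.tendsto 1).mono_left (nhdsWithin_le_nhds (s := Iio 1))
    have hge := ge_of_tendsto (b := 0) ht (by
      filter_upwards [Ioo_mem_nhdsLT (show (0 : ℝ) < 1 by norm_num)] with r hr
      have hn : ‖(r * w : ℂ)‖ = r := by simp [hw, abs_of_pos hr.1]
      have hm : (r * w : ℂ) ∈ ball (0 : ℂ) 1 := by rw [mem_ball_zero_iff, hn]; exact hr.2
      have := hpos _ hm
      rw [hk _ hm, hn] at this
      linarith)
    have e : (c0 + c1 * w + k * w ^ 2 + conj c1 * w ^ 3 + conj c0 * w ^ 4) * conj w ^ 2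
        = k + (c1 * conj w + conj (c1 * conj w)) + (c0 * conj w ^ 2 + conj (c0 * conj w ^ 2)) := by
      simp only [map_mul, map_pow, Complex.conj_conj]
      linear_combination (c1 * conj w + k * (w * conj w + 1) + conj c1 * w * (w * conj w + 1) +
        conj c0 * w ^ 2 * (w * conj w + 1)) * hww
    simp only [Complex.ofReal_one, one_mul, one_pow, sub_self, mul_zero, add_zero] at hge
    rw [e] at hge
    simp only [Complex.add_re, Complex.ofReal_re, Complex.conj_re] at hge
    linarith
  have hunit : ∀ c : ℂ, ∃ w : ℂ, ‖w‖ = 1 ∧ (c * conj w).re = -‖c‖ := by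
    intro c
    by_cases hc : c = 0
    · exact ⟨1, by simp, by simp [hc]⟩
    · have hcn : (‖c‖ : ℂ) ≠ 0 := by simpa using hc
      refine ⟨-(c / ‖c‖), by simp [hc], ?_⟩
      have : c * conj (-(c / ‖c‖)) = ((-‖c‖ : ℝ) : ℂ) := by
        simp only [map_neg, map_div₀, Complex.conj_ofReal]
        rw [mul_neg, ← mul_div_assoc, Complex.mul_conj, Complex.normSq_eq_norm_sq]
        push_cast
        field_simp
      rw [this]; simp
  have hb0 : 2 * ‖c0‖ ≤ k := by
    obtain ⟨w, hw1, hw2⟩ := hunit c0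
    obtain ⟨v, hv⟩ : ∃ v : ℂ, v ^ 2 = w :=
      ⟨w ^ (1 / 2 : ℂ), by rw [← Complex.cpow_nat_mul]; simp⟩
    have hv1 : ‖v‖ = 1 := by
      have : ‖v‖ ^ 2 = 1 := by rw [← norm_pow, hv, hw1]
      nlinarith [norm_nonneg v, pow_eq_one_iff_of_nonneg (norm_nonneg v) two_ne_zero |>.1 this]
    have h1 := hT v hv1
    have h2 := hT (-v) (by simpa using hv1)
    have h3 : (c0 * conj v ^ 2).re = -‖c0‖ := by rw [← map_pow, hv, hw2]
    have h4 : (c0 * conj (-v) ^ 2).re = -‖c0‖ := by rw [← map_pow, neg_sq, hv, hw2]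
    have h5 : (c1 * conj (-v)).re = -(c1 * conj v).re := by simp
    rw [h3] at h1
    rw [h4, h5] at h2
    linarith
  have hb1 : ‖c1‖ ≤ k := by
    obtain ⟨w, hw1, hw2⟩ := hunit c1
    have h1 := hT w hw1
    have h3 : (c0 * conj w ^ 2).re ≤ ‖c0‖ := by
      refine (Complex.re_le_norm _).trans ?_
      simp [hw1]
    linarith
  have hk0 : 0 ≤ k := le_trans (norm_nonneg _) hb1
  refine ⟨k, hk0, ?_, ?_⟩
  · rw [hk (1 / 2) (by simp; norm_num), hk (Complex.I / 2) (by simp; norm_num),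
      hk (-1 / 2) (by simp; norm_num), hk (-Complex.I / 2) (by simp; norm_num)]
    ring_nf
    simp only [Complex.I_sq, Complex.I_pow_three, Complex.I_pow_four]
    ring
  · intro z hz
    rw [mem_ball_zero_iff] at hz
    rw [hk z (by simpa using hz)]
    have hp : ∀ n : ℕ, ∀ c : ℂ, ‖c * z ^ n‖ ≤ ‖c‖ := by
      intro n c
      rw [norm_mul, norm_pow]
      exact mul_le_of_le_one_right (norm_nonneg _) (pow_le_one₀ (norm_nonneg _) hz.le)
    have e1 := hp 1 c1
    have e2 := hp 2 k
    have e3 := hp 3 (conj c1)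
    have e4 := hp 4 (conj c0)
    rw [pow_one] at e1
    rw [RCLike.norm_conj] at e3 e4
    rw [Complex.norm_real, Real.norm_of_nonneg hk0] at e2
    have t1 := norm_add_le (c0 + c1 * z + k * z ^ 2 + conj c1 * z ^ 3) (conj c0 * z ^ 4)
    have t2 := norm_add_le (c0 + c1 * z + k * z ^ 2) (conj c1 * z ^ 3)
    have t3 := norm_add_le (c0 + c1 * z) (k * z ^ 2)
    have t4 := norm_add_le c0 (c1 * z)
    linarith


/-- the model domain -/
def Om : Set (ℂ × ℂ) := {z | ‖z.1‖ ^ 2 + ‖z.2 + z.1 ^ 2 / 2‖ + ‖z.2 - z.1 ^ 2 / 2‖ < 2}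

lemma Om_mem {s q : ℂ} : (s, q) ∈ Om ↔ ‖s‖ ^ 2 + ‖q + s ^ 2 / 2‖ + ‖q - s ^ 2 / 2‖ < 2 := Iff.rfl

lemma Om_open : IsOpen Om := by
  apply isOpen_lt _ continuous_const
  fun_prop

lemma Om_zero : ((0, 0) : ℂ × ℂ) ∈ Om := by simp [Om]

lemma Om_fst {z : ℂ × ℂ} (hz : z ∈ Om) : ‖z.1‖ < 1 := by
  have h : ‖z.1‖ ^ 2 + ‖z.2 + z.1 ^ 2 / 2‖ + ‖z.2 - z.1 ^ 2 / 2‖ < 2 := hz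
  have h1 := norm_sub_le (z.2 + z.1 ^ 2 / 2) (z.2 - z.1 ^ 2 / 2)
  have h2 : (z.2 + z.1 ^ 2 / 2) - (z.2 - z.1 ^ 2 / 2) = z.1 ^ 2 := by ring
  rw [h2, norm_pow] at h1
  nlinarith [norm_nonneg z.1]

lemma Om_snd {z : ℂ × ℂ} (hz : z ∈ Om) : 2 * ‖z.2‖ + ‖z.1‖ ^ 2 < 2 := by
  have h : ‖z.1‖ ^ 2 + ‖z.2 + z.1 ^ 2 / 2‖ + ‖z.2 - z.1 ^ 2 / 2‖ < 2 := hz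
  have h1 := norm_add_le (z.2 + z.1 ^ 2 / 2) (z.2 - z.1 ^ 2 / 2)
  have h2 : (z.2 + z.1 ^ 2 / 2) + (z.2 - z.1 ^ 2 / 2) = 2 * z.2 := by ring
  rw [h2, norm_mul] at h1
  norm_num at h1
  linarith

lemma Om_of {s q : ℂ} (h : ‖s‖ ^ 2 + ‖q‖ < 1) : (s, q) ∈ Om := by
  rw [Om_mem]
  have h1 := norm_add_le q (s ^ 2 / 2)
  have h2 := norm_sub_le q (s ^ 2 / 2)
  have h3 : ‖s ^ 2 / 2‖ = ‖s‖ ^ 2 / 2 := by simp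
  linarith

lemma Om_scale {z : ℂ × ℂ} (hz : z ∈ Om) {l : ℂ} (hl : ‖l‖ ≤ 1) :
    (l * z.1, l ^ 2 * z.2) ∈ Om := by
  have h : ‖z.1‖ ^ 2 + ‖z.2 + z.1 ^ 2 / 2‖ + ‖z.2 - z.1 ^ 2 / 2‖ < 2 := hz
  rw [Om_mem]
  have e1 : l ^ 2 * z.2 + (l * z.1) ^ 2 / 2 = l ^ 2 * (z.2 + z.1 ^ 2 / 2) := by ring
  have e2 : l ^ 2 * z.2 - (l * z.1) ^ 2 / 2 = l ^ 2 * (z.2 - z.1 ^ 2 / 2) := by ring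
  rw [e1, e2, norm_mul, norm_mul, norm_mul, norm_pow]
  have : ‖l‖ ^ 2 ≤ 1 := pow_le_one₀ (norm_nonneg _) hl
  have e3 : (‖l‖ * ‖z.1‖) ^ 2 + ‖l‖ ^ 2 * ‖z.2 + z.1 ^ 2 / 2‖ + ‖l‖ ^ 2 * ‖z.2 - z.1 ^ 2 / 2‖
    = ‖l‖ ^ 2 * (‖z.1‖ ^ 2 + ‖z.2 + z.1 ^ 2 / 2‖ + ‖z.2 - z.1 ^ 2 / 2‖) := by ring
  rw [e3]
  refine lt_of_le_of_lt (mul_le_of_le_one_left (by positivity) this) h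

lemma Om_disc {l : ℂ} (hl : ‖l‖ < 1) {k : ℝ} (hk : |k| ≤ 1 / 2) : (l, (k : ℂ) * l ^ 2) ∈ Om := by
  rw [Om_mem]
  rw [abs_le] at hk
  have e1 : (k : ℂ) * l ^ 2 + l ^ 2 / 2 = ((k + 1 / 2 : ℝ) : ℂ) * l ^ 2 := by push_cast; ring
  have e2 : (k : ℂ) * l ^ 2 - l ^ 2 / 2 = ((k - 1 / 2 : ℝ) : ℂ) * l ^ 2 := by push_cast; ring
  rw [e1, e2, norm_mul, norm_mul, Complex.norm_real, Complex.norm_real, norm_pow,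
    Real.norm_of_nonneg (by linarith), Real.norm_of_nonpos (by linarith)]
  nlinarith [norm_nonneg l]

open ComplexConjugate in
lemma Om_W {s q : ℂ} (hz : (s, q) ∈ Om) {e : ℂ} (he : e = 1 ∨ e = -1) :
    ‖(s ^ 2 / 2 - e * q) * conj s ^ 2‖ - ((s ^ 2 / 2 - e * q) * conj s ^ 2).re
      ≤ 2 * (1 - ‖s‖ ^ 2) := by
  rw [Om_mem] at hz
  set W := s ^ 2 / 2 - e * q with hW
  have h1 : ‖W‖ + ‖s ^ 2 - W‖ + ‖s‖ ^ 2 < 2 := by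
    rcases he with rfl | rfl
    · have a : ‖W‖ = ‖q - s ^ 2 / 2‖ := by rw [hW, ← norm_neg]; congr 1; ring
      have b : s ^ 2 - W = q + s ^ 2 / 2 := by rw [hW]; ring
      rw [a, b]; linarith
    · have a : W = q + s ^ 2 / 2 := by rw [hW]; ring
      have b : ‖s ^ 2 - W‖ = ‖q - s ^ 2 / 2‖ := by rw [hW, ← norm_neg]; congr 1; ring
      rw [b, a]; linarith
  have hs : ‖s‖ < 1 := Om_fst (z := (s, q)) (Om_mem.2 hz)
  have h2 : ‖s‖ ^ 4 - (W * conj s ^ 2).re ≤ ‖s ^ 2 - W‖ * ‖s‖ ^ 2 := by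
    have : ((s ^ 2 - W) * conj s ^ 2).re ≤ ‖(s ^ 2 - W) * conj s ^ 2‖ := Complex.re_le_norm _
    rw [norm_mul, norm_pow, RCLike.norm_conj] at this
    have e : (s ^ 2 - W) * conj s ^ 2 = ((‖s‖ ^ 4 : ℝ) : ℂ) - W * conj s ^ 2 := by
      have : s * conj s = ((‖s‖ ^ 2 : ℝ) : ℂ) := by
        rw [Complex.mul_conj, Complex.normSq_eq_norm_sq]
      push_cast at this ⊢
      linear_combination (s * conj s + (‖s‖ : ℂ) ^ 2) * this
    rw [e, Complex.sub_re, Complex.ofReal_re] at this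
    exact this
  rw [norm_mul, norm_pow, RCLike.norm_conj]
  have h3 : (‖W‖ + ‖s ^ 2 - W‖ + ‖s‖ ^ 2) * ‖s‖ ^ 2 ≤ 2 * ‖s‖ ^ 2 :=
    mul_le_mul_of_nonneg_right h1.le (by positivity)
  have h4 : ‖s‖ ^ 2 ≤ 1 := pow_le_one₀ (norm_nonneg _) hs.le
  nlinarith [sq_nonneg ‖s‖, sq_nonneg (1 - ‖s‖ ^ 2)]

lemma Om_slice_convex (s : ℂ) : Convex ℝ {q : ℂ | (s, q) ∈ Om} := by
  have hc : ConvexOn ℝ univ (fun q : ℂ => ‖s‖ ^ 2 + ‖q + s ^ 2 / 2‖ + ‖q - s ^ 2 / 2‖) := by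
    refine ((convexOn_const _ convex_univ).add ?_).add ?_
    · exact (convexOn_univ_norm (E := ℂ)).translate_left (c := s ^ 2 / 2)
    · have := (convexOn_univ_norm (E := ℂ)).translate_left (c := - (s ^ 2 / 2))
      simpa [Function.comp_def, sub_eq_add_neg] using this
  have := hc.convex_lt 2
  simpa [Om] using this

lemma lemma_U {Y : ℂ × ℂ → ℂ} (hY : DifferentiableOn ℂ Y Om)
    (h0 : ∀ l : ℂ, ‖l‖ < 1 → ∀ k : ℝ, |k| ≤ 1 / 2 → Y (l, k * l ^ 2) = 0) :
    ∀ z ∈ Om, Y z = 0 := by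
  have main : ∀ s q : ℂ, s ≠ 0 → (s, q) ∈ Om → Y (s, q) = 0 := by
    intro s q hs hz
    have hs1 : ‖s‖ < 1 := Om_fst hz
    have hTo : IsOpen {q : ℂ | (s, q) ∈ Om} :=
      Om_open.preimage (by fun_prop : Continuous (fun q : ℂ => (s, q)))
    have hd : DifferentiableOn ℂ (fun q => Y (s, q)) {q : ℂ | (s, q) ∈ Om} :=
      hY.comp (by fun_prop) (fun q hq => hq)
    have h00 : (0 : ℂ) ∈ {q : ℂ | (s, q) ∈ Om} := by
      have := Om_disc hs1 (k := 0) (by norm_num)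
      simpa using this
    refine (hd.analyticOnNhd hTo).eqOn_zero_of_preconnected_of_frequently_eq_zero
      (Om_slice_convex s).isPreconnected h00 ?_ hz
    have ht : Tendsto (fun k : ℝ => (k : ℂ) * s ^ 2) (𝓝[>] 0) (𝓝[≠] 0) := by
      apply tendsto_nhdsWithin_iff.2 ⟨?_, ?_⟩
      · have : Continuous (fun k : ℝ => (k : ℂ) * s ^ 2) := by fun_prop
        have := (this.tendsto 0).mono_left (nhdsWithin_le_nhds (s := Ioi 0))
        simpa using this
      · filter_upwards [self_mem_nhdsWithin] with k hk
        have : k ≠ 0 := (mem_Ioi.1 hk).ne'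
        simp [hs, this]
    apply ht.frequently
    apply Eventually.frequently
    filter_upwards [Ioo_mem_nhdsGT (show (0 : ℝ) < 1 / 2 by norm_num)] with k hk
    exact h0 s hs1 k (by rw [abs_of_pos hk.1]; exact hk.2.le)
  rintro ⟨s, q⟩ hz
  by_cases hs : s = 0
  · subst hs
    have hc : ContinuousAt Y (0, q) := hY.continuousOn.continuousAt (Om_open.mem_nhds hz)
    have hl : Tendsto (fun s : ℂ => (s, q)) (𝓝[≠] 0) (𝓝 (0, q)) := by
      have : Continuous (fun s : ℂ => (s, q)) := by fun_prop
      exact (this.tendsto 0).mono_left nhdsWithin_le_nhds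
    have h1 := hc.tendsto.comp hl
    refine tendsto_nhds_unique h1 (tendsto_const_nhds.congr' ?_)
    filter_upwards [hl (Om_open.mem_nhds hz), self_mem_nhdsWithin] with s h1 h2
    exact (main s q h2 h1).symm
  · exact main s q hs hz


structure OmFlow (f : ℝ → ℂ × ℂ → ℂ × ℂ) (X : ℂ × ℂ → ℂ × ℂ) : Prop where
  maps : ∀ t z, z ∈ Om → f t z ∈ Om
  hol : ∀ t, DifferentiableOn ℂ (f t) Om
  zero : ∀ z ∈ Om, f 0 z = z
  der : ∀ t z, z ∈ Om → HasDerivAt (fun t => f t z) (X (f t z)) t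
  Xhol : DifferentiableOn ℂ X Om

lemma OmFlow.der1 {f X} (h : OmFlow f X) {z} (hz : z ∈ Om) (t : ℝ) :
    HasDerivAt (fun t => (f t z).1) (X (f t z)).1 t := 
  (ContinuousLinearMap.fst ℝ ℂ ℂ).hasFDerivAt.comp_hasDerivAt t (h.der t z hz)

lemma OmFlow.der2 {f X} (h : OmFlow f X) {z} (hz : z ∈ Om) (t : ℝ) :
    HasDerivAt (fun t => (f t z).2) (X (f t z)).2 t := 
  (ContinuousLinearMap.snd ℝ ℂ ℂ).hasFDerivAt.comp_hasDerivAt t (h.der t z hz)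

structure AutPair (φ ψ : ℂ × ℂ → ℂ × ℂ) : Prop where
  hφ : DifferentiableOn ℂ φ Om
  hψ : DifferentiableOn ℂ ψ Om
  mφ : ∀ z ∈ Om, φ z ∈ Om
  mψ : ∀ z ∈ Om, ψ z ∈ Om
  l : ∀ z ∈ Om, ψ (φ z) = z
  r : ∀ z ∈ Om, φ (ψ z) = z

lemma AutPair.symm {φ ψ} (h : AutPair φ ψ) : AutPair ψ φ :=
  ⟨h.hψ, h.hφ, h.mψ, h.mφ, h.r, h.l⟩

lemma diff_fderiv2 {F : ℂ × ℂ → ℂ × ℂ} (hF : DifferentiableOn ℂ F Om) (v : ℂ × ℂ) :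
    DifferentiableOn ℂ (fun z => fderiv ℂ F z v) Om := by
  have h1 := diff_fderiv Om_open (F := fun z => (F z).1) hF.fst v
  have h2 := diff_fderiv Om_open (F := fun z => (F z).2) hF.snd v
  refine (h1.prodMk h2).congr ?_
  intro z hz
  have hd : DifferentiableAt ℂ F z := hF.differentiableAt (Om_open.mem_nhds hz)
  rw [fderiv.fst hd, fderiv.snd hd]
  rfl

lemma AutPair.flow {φ ψ} (h : AutPair φ ψ) :
    OmFlow (fun t z => ψ (Complex.exp (t * Complex.I) * (φ z).1,
      Complex.exp (t * Complex.I) ^ 2 * (φ z).2))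
      (fun z => fderiv ℂ ψ (φ z) (Complex.I * (φ z).1, 2 * Complex.I * (φ z).2)) := by
  have hn : ∀ t : ℝ, ‖Complex.exp (t * Complex.I)‖ ≤ 1 := fun t =>
    (Complex.norm_exp_ofReal_mul_I t).le
  refine ⟨?_, ?_, ?_, ?_, ?_⟩
  · intro t z hz
    exact h.mψ _ (Om_scale (h.mφ z hz) (hn t))
  · intro t
    have := h.hφ
    refine h.hψ.comp (t := Om) ?_ (fun z hz => Om_scale (h.mφ z hz) (hn t))
    exact (this.fst.const_mul _).prodMk (this.snd.const_mul _)
  · intro z hz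
    simp [h.l z hz]
  · intro t z hz
    have hm := Om_scale (h.mφ z hz) (hn t)
    rw [h.r _ hm]
    have he : HasDerivAt (fun t : ℝ => Complex.exp (t * Complex.I))
        (Complex.exp (t * Complex.I) * Complex.I) t := by
      have h1 : HasDerivAt (fun t : ℝ => (t : ℂ) * Complex.I) Complex.I t := by
        simpa using (Complex.ofRealCLM.hasDerivAt (x := t)).mul_const Complex.I
      exact h1.cexp
    have h1 := he.mul_const (φ z).1
    have h2 := (he.pow 2).mul_const (φ z).2
    have h3 := h1.prodMk h2
    have hd : HasFDerivAt ψ _ _ := (h.hψ.differentiableAt (Om_open.mem_nhds hm)).hasFDerivAt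
    have := (hd.restrictScalars ℝ).comp_hasDerivAt t h3
    refine this.congr_deriv ?_
    simp only [ContinuousLinearMap.coe_restrictScalars']
    congr 1
    ext <;> simp <;> ring
  · have d1 := (diff_fderiv2 h.hψ (1, 0)).comp h.hφ h.mφ
    have d2 := (diff_fderiv2 h.hψ (0, 1)).comp h.hφ h.mφ
    refine (((h.hφ.fst.const_mul Complex.I).smul d1).add 
      ((h.hφ.snd.const_mul (2 * Complex.I)).smul d2)).congr ?_
    intro z hz
    change _ = (Complex.I * (φ z).1) • fderiv ℂ ψ (φ z) (1, 0) +
      (2 * Complex.I * (φ z).2) • fderiv ℂ ψ (φ z) (0, 1)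
    rw [← map_smul, ← map_smul, ← map_add]
    congr 1
    ext <;> simp

lemma AutPair.zero_of_X {φ ψ} (h : AutPair φ ψ) {z} (hz : z ∈ Om)
    (hX : fderiv ℂ ψ (φ z) (Complex.I * (φ z).1, 2 * Complex.I * (φ z).2) = 0) : φ z = (0, 0) := by
  have hw := h.mφ z hz
  have hd1 := (h.hψ.differentiableAt (Om_open.mem_nhds hw)).hasFDerivAt
  have hd2 : HasFDerivAt φ _ (ψ (φ z)) := 
    (h.hφ.differentiableAt (Om_open.mem_nhds (h.mψ _ hw))).hasFDerivAt
  have h3 := hd2.comp (φ z) hd1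
  have h4 : HasFDerivAt (φ ∘ ψ) (ContinuousLinearMap.id ℂ (ℂ × ℂ)) (φ z) := by
    refine (hasFDerivAt_id (φ z)).congr_of_eventuallyEq ?_
    filter_upwards [Om_open.mem_nhds hw] with w hw
    exact h.r w hw
  have h5 := h3.unique h4
  have h6 := congrArg (fun L => L (Complex.I * (φ z).1, 2 * Complex.I * (φ z).2)) h5
  simp only [ContinuousLinearMap.comp_apply, hX, map_zero, ContinuousLinearMap.id_apply] at h6
  have a := congrArg Prod.fst h6
  have b := congrArg Prod.snd h6
  simp at a b
  ext <;> simp [a, b]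

open ComplexConjugate in
lemma norm_one_sub_sq (a c : ℂ) : ‖1 - conj a * c‖ ^ 2 - ‖c - a‖ ^ 2 = (1 - ‖a‖ ^ 2) * (1 - ‖c‖ ^ 2) := by
  simp only [← Complex.normSq_eq_norm_sq, Complex.normSq_apply]
  simp
  ring

open ComplexConjugate in
lemma mobius_ne {a c : ℂ} (ha : ‖a‖ < 1) (hc : ‖c‖ < 1) : 1 - conj a * c ≠ 0 := by
  intro h
  have := norm_one_sub_sq a c
  rw [h] at this
  have h1 : 0 < (1 - ‖a‖ ^ 2) * (1 - ‖c‖ ^ 2) := by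
    apply mul_pos <;> nlinarith [norm_nonneg a, norm_nonneg c]
  simp at this
  nlinarith [sq_nonneg ‖c - a‖]

open ComplexConjugate in
lemma mobius_lt {a c : ℂ} (ha : ‖a‖ < 1) (hc : ‖c‖ < 1) : ‖(c - a) / (1 - conj a * c)‖ < 1 := by
  have h0 := mobius_ne ha hc
  have := norm_one_sub_sq a c
  have h1 : 0 < (1 - ‖a‖ ^ 2) * (1 - ‖c‖ ^ 2) := by
    apply mul_pos <;> nlinarith [norm_nonneg a, norm_nonneg c]
  rw [norm_div, div_lt_one (norm_pos_iff.2 h0)]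
  apply lt_of_pow_lt_pow_left₀ 2 (norm_nonneg _)
  linarith

open ComplexConjugate in
lemma schwarz_pick {F : ℂ → ℂ} (hd : DifferentiableOn ℂ F (ball 0 1))
    (hm : ∀ z, ‖z‖ < 1 → ‖F z‖ < 1) {z : ℂ} (hz : ‖z‖ < 1) :
    ‖F z - F 0‖ ^ 2 ≤ ‖z‖ ^ 2 * ‖1 - conj (F 0) * F z‖ ^ 2 := by
  have hF0 := hm 0 (by simp)
  have hb : ∀ w ∈ ball (0 : ℂ) 1, ‖F w‖ < 1 := fun w hw => hm w (by simpa using hw)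
  have h1 : ‖(F z - F 0) / (1 - conj (F 0) * F z)‖ ≤ ‖z‖ := by
    refine Complex.norm_le_norm_of_mapsTo_ball (f := fun w => (F w - F 0) / (1 - conj (F 0) * F w))
      (R := 1) ?_ ?_ ?_ hz
    · refine (hd.sub_const _).div ((hd.const_mul _).const_sub _) ?_
      intro w hw
      exact mobius_ne hF0 (hb w hw)
    · intro w hw
      rw [mem_closedBall_zero_iff]
      exact (mobius_lt hF0 (hb w hw)).le
    · simp
  rw [norm_div, div_le_iff₀ (norm_pos_iff.2 (mobius_ne hF0 (hm z hz)))] at h1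
  rw [← mul_pow]
  exact pow_le_pow_left₀ (norm_nonneg _) h1 2


lemma disc_diff {Y : ℂ × ℂ → ℂ} (hY : DifferentiableOn ℂ Y Om) {k : ℝ} (hk : |k| ≤ 1 / 2) :
    DifferentiableOn ℂ (fun l : ℂ => Y (l, k * l ^ 2)) (ball 0 1) := by
  refine hY.comp (t := Om) (f := fun l : ℂ => (l, (k : ℂ) * l ^ 2)) (by fun_prop) ?_
  intro l hl
  exact Om_disc (by simpa using hl) hk

lemma disc_deriv {Y : ℂ × ℂ → ℂ} (hY : DifferentiableOn ℂ Y Om) (k : ℝ) :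
    HasDerivAt (fun l : ℂ => Y (l, k * l ^ 2)) (fderiv ℂ Y (0, 0) (1, 0)) 0 := by
  have h1 : HasDerivAt (fun l : ℂ => (l, (k : ℂ) * l ^ 2)) ((1 : ℂ), (0 : ℂ)) 0 := by
    have := (hasDerivAt_id (0 : ℂ)).prodMk (((hasDerivAt_id (0 : ℂ)).pow 2).const_mul (k : ℂ))
    refine this.congr_deriv ?_
    simp
  have h2 : HasFDerivAt Y (fderiv ℂ Y (0, 0)) ((fun l : ℂ => (l, (k : ℂ) * l ^ 2)) 0) := by
    simpa using (hY.differentiableAt (Om_open.mem_nhds Om_zero)).hasFDerivAt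
  exact h2.comp_hasDerivAt (0 : ℂ) h1

open ComplexConjugate in
lemma OmFlow.stepA0 {f X} (h : OmFlow f X) {k : ℝ} (hk : |k| ≤ 1 / 2) {l : ℂ} (hl : ‖l‖ < 1) :
    (conj l * ((X (l, k * l ^ 2)).1 - (X (0, 0)).1 + conj (X (0, 0)).1 * l ^ 2)).re = 0 := by
  have hz : (l, (k : ℂ) * l ^ 2) ∈ Om := Om_disc hl hk
  have d1 := h.der1 hz 0
  have d0 := h.der1 Om_zero 0
  rw [h.zero _ hz] at d1
  rw [h.zero _ Om_zero] at d0
  have dc : HasDerivAt (fun t => conj (f t (0, 0)).1) (conj (X (0, 0)).1) 0 := by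
    exact (Complex.conjCLE.toContinuousLinearMap).hasFDerivAt.comp_hasDerivAt 0 d0
  have e1 := (((dc.mul d1).const_sub 1).norm_sq).const_mul (‖l‖ ^ 2)
  have e2 := (d1.sub d0).norm_sq
  have e3 := e1.sub e2
  have hmin : IsLocalMin ((fun t => ‖l‖ ^ 2 * ‖1 - conj (f t (0, 0)).1 * (f t (l, k * l ^ 2)).1‖ ^ 2)
      - (fun t => ‖(f t (l, k * l ^ 2)).1 - (f t (0, 0)).1‖ ^ 2)) 0 := by
    refine Eventually.of_forall fun t => ?_
    simp only [Pi.sub_apply]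
    rw [h.zero _ hz, h.zero _ Om_zero]
    have := schwarz_pick (disc_diff (Y := fun z => (f t z).1) (h.hol t).fst hk)
      (fun w hw => Om_fst (h.maps t _ (Om_disc hw hk))) hl
    simp only [ne_eq, OfNat.ofNat_ne_zero, not_false_eq_true, zero_pow, mul_zero] at this
    simp only [map_zero, zero_mul, sub_zero, norm_one, one_pow, mul_one, sub_self]
    linarith
  have e4 := hmin.hasDerivAt_eq_zero e3
  simp only [Complex.inner, h.zero _ hz, h.zero _ Om_zero, Pi.sub_apply, Pi.mul_apply] at e4
  have hl2 : ‖l‖ ^ 2 = l.re ^ 2 + l.im ^ 2 := by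
    rw [← Complex.normSq_eq_norm_sq, Complex.normSq_apply]; ring
  rw [hl2] at e4
  simp [pow_two] at e4 ⊢
  linarith

open ComplexConjugate in
lemma OmFlow.stepA {f X} (h : OmFlow f X) : ∃ c : ℂ, c.re = 0 ∧ ∀ z ∈ Om,
    (X z).1 = (X (0, 0)).1 - conj (X (0, 0)).1 * z.1 ^ 2 + c * z.1 := by
  have hX1 : DifferentiableOn ℂ (fun z => (X z).1) Om := h.Xhol.fst
  set α := (X (0, 0)).1 with hα
  set c := fderiv ℂ (fun z => (X z).1) (0, 0) (1, 0) with hc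
  have key : ∀ k : ℝ, |k| ≤ 1 / 2 → c.re = 0 ∧ ∀ l : ℂ, ‖l‖ < 1 → 
      (X (l, k * l ^ 2)).1 = α - conj α * l ^ 2 + c * l := by
    intro k hk
    set g : ℂ → ℂ := fun l => (X (l, k * l ^ 2)).1 - α + conj α * l ^ 2 with hg
    have hgd : DifferentiableOn ℂ g (ball 0 1) :=
      ((disc_diff hX1 hk).sub_const α).add (by fun_prop)
    have hg0 : g 0 = 0 := by simp [hg, hα]
    have hg' : HasDerivAt g c 0 := by
      have h1 := disc_deriv hX1 k
      have h2 := (((hasDerivAt_id (0 : ℂ)).pow 2).const_mul (conj α))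
      have := (h1.sub_const α).add h2
      refine this.congr_deriv ?_
      simp [hc]
    have hdd : DifferentiableOn ℂ (dslope g 0) (ball 0 1) :=
      (Complex.differentiableOn_dslope (ball_mem_nhds _ one_pos)).2 hgd
    have hgl : ∀ l, g l = l * dslope g 0 l := by
      intro l
      have := sub_smul_dslope g 0 l
      simp [hg0] at this
      exact this.symm
    have hre : ∀ l : ℂ, l ≠ 0 → ‖l‖ < 1 → (dslope g 0 l).re = 0 := by
      intro l hl0 hl
      have h1 := h.stepA0 hk hl
      change (conj l * g l).re = 0 at h1
      rw [hgl, ← mul_assoc, mul_comm (conj l), Complex.mul_conj, Complex.re_ofReal_mul] at h1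
      have : Complex.normSq l ≠ 0 := by simpa using hl0
      exact (mul_eq_zero.1 h1).resolve_left this
    obtain ⟨m, hm⟩ := const_of_im_small (h := fun l => Complex.I * dslope g 0 l)
      (hdd.const_mul _) (by
        intro ε hε
        refine ⟨1 / 2, by norm_num, fun z hz1 hz2 => ?_⟩
        have : z ≠ 0 := by
          rintro rfl
          simp at hz1
          linarith
        simp [hre z this hz2, hε.le])
    have hd0 : dslope g 0 0 = c := by rw [dslope_same, hg'.deriv]
    have hm' : ∀ z ∈ ball (0 : ℂ) 1, dslope g 0 z = c := by
      intro z hz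
      have h1 := hm z hz
      have h2 := hm 0 (by simp)
      rw [hd0] at h2
      exact mul_left_cancel₀ Complex.I_ne_zero (h1.trans h2.symm)
    constructor
    · have h3 := hre (1 / 2) (by norm_num) (by norm_num)
      rw [hm' _ (by simp; norm_num)] at h3
      exact h3
    · intro l hl
      have h1 := hgl l
      rw [hm' l (by simpa using hl)] at h1
      simp only [hg] at h1
      linear_combination h1
  refine ⟨c, (key 0 (by norm_num)).1, ?_⟩
  intro z hz
  have := lemma_U (Y := fun z => (X z).1 - (α - conj α * z.1 ^ 2 + c * z.1))
    (hX1.sub (by fun_prop)) (fun l hl k hk => by simp [(key k hk).2 l hl]) z hz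
  exact sub_eq_zero.1 this


open ComplexConjugate in
lemma OmFlow.stepC {f X} (h : OmFlow f X) {b : ℂ × ℂ} (hb : b ∈ Om) (hXb : X b = 0) :
    ∃ κ : ℂ, κ.re = 0 ∧ ∀ z ∈ Om, ∀ t : ℝ,
      ((f t z).1 - b.1) / (1 - conj b.1 * (f t z).1) =
        Complex.exp (κ * t) * ((z.1 - b.1) / (1 - conj b.1 * z.1)) := by
  obtain ⟨c, hc, hX⟩ := h.stepA
  set α := (X (0, 0)).1 with hα
  set β := b.1 with hβ
  have hβ1 : ‖β‖ < 1 := Om_fst hb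
  have e1 : α - conj α * β ^ 2 + c * β = 0 := by
    rw [← hX b hb, hXb]; rfl
  have cc : conj c = -c := by
    apply Complex.ext <;> simp [hc]
  have e2 : conj α - α * conj β ^ 2 - c * conj β = 0 := by
    have := congrArg conj e1
    simp only [map_add, map_sub, map_mul, map_pow, Complex.conj_conj, map_zero, cc] at this
    linear_combination this
  have hββ : β * conj β = ((‖β‖ ^ 2 : ℝ) : ℂ) := by
    rw [Complex.mul_conj, Complex.normSq_eq_norm_sq]
  have hτ : (1 - β * conj β) ≠ 0 := by
    have := mobius_ne hβ1 hβ1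
    rwa [mul_comm] at this
  have e3 : α * conj β + conj α * β = 0 := by
    have : (1 - β * conj β) * (α * conj β + conj α * β) = 0 := by
      linear_combination conj β * e1 + β * e2
    exact (mul_eq_zero.1 this).resolve_left hτ
  have e4 : conj α = (c - conj α * β) * conj β := by
    linear_combination e2 + conj β * e3
  refine ⟨(c - conj α * β) * (1 - β * conj β), ?_, ?_⟩
  · have : (conj α * β).re = 0 := by
      have := congrArg Complex.re e3
      simp at this ⊢
      linarith
    rw [hββ, ← Complex.ofReal_one, ← Complex.ofReal_sub, Complex.re_mul_ofReal, Complex.sub_re, hc,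
      this]
    simp
  · intro z hz t
    set κ := (c - conj α * β) * (1 - β * conj β) with hκ
    set m : ℝ → ℂ := fun t => ((f t z).1 - β) / (1 - conj β * (f t z).1) with hm
    have hmd : ∀ t, HasDerivAt m (κ * m t) t := by
      intro t
      have hz' := h.maps t z hz
      have d := h.der1 hz t
      have hne : 1 - conj β * (f t z).1 ≠ 0 := mobius_ne hβ1 (Om_fst hz')
      have := (d.sub_const β).div ((d.const_mul (conj β)).const_sub 1) hne
      refine this.congr_deriv ?_
      rw [hX _ hz', hm]
      simp only
      generalize (f t z).1 = S at hne ⊢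
      have hv : α - conj α * S ^ 2 + c * S = (S - β) * ((c - conj α * β) * (1 - conj β * S)) := by
        linear_combination e1 - (S - β) * S * e4
      rw [hv, hκ]
      field_simp
      ring
    have hconst : ∀ t, HasDerivAt (fun t : ℝ => Complex.exp (-(κ * t)) * m t) 0 t := by
      intro t
      have h1 : HasDerivAt (fun t : ℝ => -(κ * (t : ℂ))) (-κ) t := by
        exact (((Complex.ofRealCLM.hasDerivAt (x := t)).const_mul κ).neg).congr_deriv (by simp)
      refine (h1.cexp.mul (hmd t)).congr_deriv ?_
      ring
    have hcc := is_const_of_deriv_eq_zero (fun t => (hconst t).differentiableAt)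
      (fun t => (hconst t).deriv) t 0
    have h0 : m 0 = (z.1 - β) / (1 - conj β * z.1) := by
      simp only [hm]
      rw [h.zero z hz]
    simp only [Complex.ofReal_zero, mul_zero, neg_zero, Complex.exp_zero, one_mul, h0] at hcc
    change m t = _
    rw [← hcc, ← mul_assoc, ← Complex.exp_add]
    simp

open ComplexConjugate in
/-- the estimates needed for the nonnegative section -/
lemma section_est {s q e ν β : ℂ} (hz : (s, q) ∈ Om) (he : e = 1 ∨ e = -1) (hν : ‖ν‖ < 1)
    (hβ : ‖β‖ < 1) (hs : s * (1 + conj β * ν) = ν + β) :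
    (((1 + conj β * ν) ^ 4 * (s ^ 2 / 2 - e * q) * conj ν ^ 2).im) ^ 2 ≤ 5632 * (1 - ‖ν‖ ^ 2) ∧
    -(5632 * (1 - ‖ν‖ ^ 2)) ≤ ((1 + conj β * ν) ^ 4 * (s ^ 2 / 2 - e * q) * conj ν ^ 2).re := by
  have hW := Om_W hz he
  have hs1 : ‖s‖ < 1 := Om_fst hz
  have hq1 : 2 * ‖q‖ + ‖s‖ ^ 2 < 2 := Om_snd hz
  have he1 : ‖e‖ = 1 := by rcases he with rfl | rfl <;> simp
  have hWn : ‖s ^ 2 / 2 - e * q‖ ≤ 2 := by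
    have := norm_sub_le (s ^ 2 / 2) (e * q)
    rw [norm_mul, he1] at this
    have h3 : ‖s ^ 2 / 2‖ = ‖s‖ ^ 2 / 2 := by simp
    nlinarith [norm_nonneg s, norm_nonneg q]
  set W := s ^ 2 / 2 - e * q with hWd
  clear_value W
  set D := 1 + conj β * ν with hD
  have hDn : ‖D‖ ≤ 2 := by
    have := norm_add_le 1 (conj β * ν)
    rw [norm_mul, RCLike.norm_conj, norm_one] at this
    nlinarith [norm_nonneg β, norm_nonneg ν]
  set τ : ℝ := 1 - ‖ν‖ ^ 2 with hτ
  have hτ0 : 0 ≤ τ := by nlinarith [norm_nonneg ν]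
  have hτ1 : τ ≤ 1 := by nlinarith [norm_nonneg ν]
  have hνν : ν * conj ν = 1 - (τ : ℂ) := by
    rw [Complex.mul_conj, Complex.normSq_eq_norm_sq, hτ]; push_cast; ring
  have hDD : D * conj D = ((‖D‖ ^ 2 : ℝ) : ℂ) := by
    rw [Complex.mul_conj, Complex.normSq_eq_norm_sq]
  have hcs : conj s * conj D = conj ν + conj β := by
    rw [← map_mul, hs, map_add]
  have hk : conj ν * D = conj s * conj D - conj β * τ := by
    rw [hcs, hD]; linear_combination conj β * hνν
  have hexp : D ^ 4 * W * conj ν ^ 2 = ((‖D‖ ^ 4 : ℝ) : ℂ) * (W * conj s ^ 2) +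
      (τ : ℂ) * (D ^ 2 * W * (-2 * (conj s * conj D) * conj β + conj β ^ 2 * τ)) := by
    have : D ^ 4 * W * conj ν ^ 2 = D ^ 2 * W * (conj ν * D) ^ 2 := by ring
    rw [this, hk]
    have h4 : ((‖D‖ ^ 4 : ℝ) : ℂ) = (D * conj D) ^ 2 := by rw [hDD]; push_cast; ring
    rw [h4]; ring
  set x := D ^ 4 * W * conj ν ^ 2 with hx
  set y := ((‖D‖ ^ 4 : ℝ) : ℂ) * (W * conj s ^ 2) with hy
  set r := D ^ 2 * W * (-2 * (conj s * conj D) * conj β + conj β ^ 2 * τ) with hr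
  have hrn : ‖r‖ ≤ 40 := by
    have h1 : ‖-2 * (conj s * conj D) * conj β + conj β ^ 2 * τ‖ ≤ 5 := by
      refine (norm_add_le _ _).trans ?_
      simp only [norm_mul, norm_neg, norm_pow, RCLike.norm_conj, Complex.norm_real,
        Real.norm_of_nonneg hτ0, Complex.norm_ofNat]
      have a1 : ‖s‖ * ‖D‖ ≤ 1 * 2 := mul_le_mul hs1.le hDn (norm_nonneg _) zero_le_one
      have a2 : (‖s‖ * ‖D‖) * ‖β‖ ≤ (1 * 2) * 1 := mul_le_mul a1 hβ.le (norm_nonneg _) (by norm_num)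
      have a3 : ‖β‖ ^ 2 * τ ≤ 1 * 1 :=
        mul_le_mul (pow_le_one₀ (norm_nonneg _) hβ.le) hτ1 hτ0 zero_le_one
      linarith
    rw [hr, norm_mul, norm_mul, norm_pow]
    have h2 : ‖D‖ ^ 2 ≤ 2 ^ 2 := pow_le_pow_left₀ (norm_nonneg _) hDn 2
    calc ‖D‖ ^ 2 * ‖W‖ * ‖-2 * (conj s * conj D) * conj β + conj β ^ 2 * τ‖ ≤ (2 ^ 2 * 2) * 5 := by
          gcongr
      _ = 40 := by norm_num
  have hS : ‖D‖ ^ 2 * (1 - ‖s‖ ^ 2) ≤ τ := by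
    have h1 : ‖s‖ * ‖D‖ = ‖ν + β‖ := by rw [← norm_mul, hs]
    have h2 := norm_one_sub_sq (-β) ν
    have h3 : 1 - conj (-β) * ν = D := by rw [hD, map_neg]; ring
    rw [h3, sub_neg_eq_add, ← h1, norm_neg, ← hτ] at h2
    nlinarith [sq_nonneg ‖β‖, mul_nonneg (sq_nonneg ‖β‖) hτ0]
  have hyr : ‖y‖ - y.re ≤ 8 * τ := by
    rw [hy, norm_mul, Complex.re_ofReal_mul, Complex.norm_real, Real.norm_of_nonneg (by positivity),
      ← mul_sub]
    calc ‖D‖ ^ 4 * (‖W * conj s ^ 2‖ - (W * conj s ^ 2).re) 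
        ≤ ‖D‖ ^ 4 * (2 * (1 - ‖s‖ ^ 2)) := by gcongr
      _ = 2 * ‖D‖ ^ 2 * (‖D‖ ^ 2 * (1 - ‖s‖ ^ 2)) := by ring
      _ ≤ 2 * 2 ^ 2 * τ := by
        have hs0 : 0 ≤ 1 - ‖s‖ ^ 2 := by nlinarith [norm_nonneg s]
        gcongr
      _ = 8 * τ := by ring
  have hxy : ‖x - y‖ ≤ 40 * τ := by
    rw [hexp, add_sub_cancel_left, norm_mul, Complex.norm_real, Real.norm_of_nonneg hτ0]
    nlinarith
  have hxr : ‖x‖ - x.re ≤ 88 * τ := by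
    have a1 : ‖x‖ ≤ ‖y‖ + ‖x - y‖ := by
      have := norm_add_le y (x - y)
      rwa [add_sub_cancel] at this
    have a2 : -(x - y).re ≤ ‖x - y‖ := (neg_le_abs _).trans (Complex.abs_re_le_norm _)
    rw [Complex.sub_re] at a2
    linarith
  have hxn : ‖x‖ ≤ 32 := by
    rw [hx, norm_mul, norm_mul, norm_pow, norm_pow, RCLike.norm_conj]
    calc ‖D‖ ^ 4 * ‖W‖ * ‖ν‖ ^ 2 ≤ 2 ^ 4 * 2 * 1 ^ 2 := by gcongr
      _ = 32 := by norm_num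
  constructor
  · have h1 : x.im ^ 2 = (‖x‖ - x.re) * (‖x‖ + x.re) := by
      have : ‖x‖ ^ 2 = x.re ^ 2 + x.im ^ 2 := by
        rw [← Complex.normSq_eq_norm_sq, Complex.normSq_apply]; ring
      linarith
    rw [h1]
    have h2 : ‖x‖ + x.re ≤ 64 := by linarith [Complex.re_le_norm x]
    have h3 : 0 ≤ ‖x‖ + x.re := by linarith [neg_le_abs x.re, Complex.abs_re_le_norm x]
    calc (‖x‖ - x.re) * (‖x‖ + x.re) ≤ 88 * τ * 64 := by
          apply mul_le_mul hxr h2 h3 (by positivity)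
      _ = 5632 * τ := by ring
  · linarith [norm_nonneg x]

open ComplexConjugate in
lemma OmFlow.stepD {f X} (h : OmFlow f X) {b : ℂ × ℂ} (hb : b ∈ Om) (hXb : X b = 0)
    {e : ℝ} (he : e = 1 ∨ e = -1) {l : ℂ} (hl : ‖l‖ < 1) :
    (X (l, (e / 2 : ℝ) * l ^ 2)).2 = e * l * (X (l, (e / 2 : ℝ) * l ^ 2)).1 := by
  obtain ⟨κ, hκ, hm⟩ := h.stepC hb hXb
  set β := b.1 with hβ
  have hβ1 : ‖β‖ < 1 := Om_fst hb
  have hek : |e / 2| ≤ 1 / 2 := by rcases he with rfl | rfl <;> norm_num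
  have hec : (e : ℂ) = 1 ∨ (e : ℂ) = -1 := by rcases he with rfl | rfl <;> simp
  have hee : (e : ℂ) * e = 1 := by rcases hec with h | h <;> simp [h]
  set M : ℂ → ℂ := fun ν => (ν + β) / (1 + conj β * ν) with hM
  have hne : ∀ ν : ℂ, ‖ν‖ < 1 → 1 + conj β * ν ≠ 0 := by
    intro ν hν
    have := mobius_ne (a := -β) (by simpa using hβ1) hν
    simpa using this
  have hM1 : ∀ ν : ℂ, ‖ν‖ < 1 → ‖M ν‖ < 1 := by
    intro ν hν
    have := mobius_lt (a := -β) (by simpa using hβ1) hν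
    simpa [hM] using this
  have hMd : DifferentiableOn ℂ M (ball 0 1) := by
    refine DifferentiableOn.div (by fun_prop) (by fun_prop) ?_
    intro ν hν
    exact hne ν (by simpa using hν)
  set zz : ℂ → ℂ × ℂ := fun ν => (M ν, ((e / 2 : ℝ) : ℂ) * (M ν) ^ 2) with hzz
  have hzm : ∀ ν : ℂ, ‖ν‖ < 1 → zz ν ∈ Om := fun ν hν => Om_disc (hM1 ν hν) hek
  have hzd : DifferentiableOn ℂ zz (ball 0 1) := hMd.prodMk ((hMd.pow 2).const_mul _)
  set R : ℝ → ℂ → ℂ := fun t ν => Complex.exp (-2 * κ * t) *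
    ((1 + conj β * (Complex.exp (κ * t) * ν)) ^ 4 *
      ((f t (zz ν)).1 ^ 2 / 2 - e * (f t (zz ν)).2)) with hR
  have hen : ∀ t : ℝ, ‖Complex.exp (κ * t)‖ = 1 := by
    intro t
    rw [Complex.norm_exp]
    simp [hκ]
  have hRd : ∀ t, DifferentiableOn ℂ (R t) (ball 0 1) := by
    intro t
    have hc : DifferentiableOn ℂ (fun ν => f t (zz ν)) (ball 0 1) :=
      (h.hol t).comp hzd (fun ν hν => hzm ν (by simpa using hν))
    refine DifferentiableOn.const_mul (DifferentiableOn.mul (by fun_prop) ?_) _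
    exact ((hc.fst.pow 2).div_const 2).sub (hc.snd.const_mul _)
  have hflow : ∀ t : ℝ, ∀ ν : ℂ, ‖ν‖ < 1 → (f t (zz ν)).1 * (1 + conj β * (Complex.exp (κ * t) * ν))
      = Complex.exp (κ * t) * ν + β := by
    intro t ν hν
    have h1 := hm _ (hzm ν hν) t
    have h2 : ((zz ν).1 - β) / (1 - conj β * (zz ν).1) = ν := by
      have hn1 : 1 - conj β * (zz ν).1 ≠ 0 := mobius_ne hβ1 (Om_fst (hzm ν hν))
      rw [div_eq_iff hn1]
      simp only [hzz, hM]
      have hu := div_mul_cancel₀ (ν + β) (hne ν hν)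
      linear_combination hu
    rw [h2] at h1
    have hn2 : 1 - conj β * (f t (zz ν)).1 ≠ 0 := mobius_ne hβ1 (Om_fst (h.maps t _ (hzm ν hν)))
    rw [div_eq_iff hn2] at h1
    linear_combination h1
  have hsec : ∀ t : ℝ, ∃ k : ℝ, 0 ≤ k ∧
      R t (1 / 2) - R t (Complex.I / 2) + R t (-1 / 2) - R t (-Complex.I / 2) = k ∧
      ∀ z ∈ ball (0 : ℂ) 1, ‖R t z‖ ≤ 5 * k := by
    intro t
    have hest : ∀ ν ∈ ball (0 : ℂ) 1, _ := fun ν hν =>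
      section_est (h.maps t _ (hzm ν (by simpa using hν))) hec
        (ν := Complex.exp (κ * t) * ν) (by rw [norm_mul, hen]; simpa using hν) hβ1
        (hflow t ν (by simpa using hν))
    have hid : ∀ ν : ℂ, R t ν * conj ν ^ 2 = (1 + conj β * (Complex.exp (κ * t) * ν)) ^ 4 *
        ((f t (zz ν)).1 ^ 2 / 2 - e * (f t (zz ν)).2) * conj (Complex.exp (κ * t) * ν) ^ 2 := by
      intro ν
      have : conj (Complex.exp (κ * t)) ^ 2 = Complex.exp (-2 * κ * t) := by
        rw [← Complex.exp_conj, ← Complex.exp_nat_mul]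
        congr 1
        have cc : conj κ = -κ := by
          apply Complex.ext <;> simp [hκ]
        rw [map_mul, cc, Complex.conj_ofReal]
        push_cast; ring
      rw [map_mul, mul_pow, this]
      simp only [hR]
      ring
    refine section_nonneg (hRd t) (C := 5632) ?_ ?_
    · intro ν hν
      have := (hest ν hν).1
      rw [norm_mul, hen, one_mul] at this
      rw [hid]; exact this
    · intro ν hν
      have := (hest ν hν).2
      rw [norm_mul, hen, one_mul] at this
      rw [hid]; exact this
  choose K hK0 hKe hKb using hsec
  -- derivative of R
  have hW0 : ∀ ν : ℂ, ‖ν‖ < 1 → (f 0 (zz ν)).1 ^ 2 / 2 - e * (f 0 (zz ν)).2 = 0 := by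
    intro ν hν
    rw [h.zero _ (hzm ν hν)]
    simp only [hzz]
    push_cast
    linear_combination (-(M ν) ^ 2 / 2) * hee
  have hRder : ∀ ν : ℂ, ‖ν‖ < 1 → HasDerivAt (fun t => R t ν)
      ((1 + conj β * ν) ^ 4 * (M ν * (X (zz ν)).1 - e * (X (zz ν)).2)) 0 := by
    intro ν hν
    have d1 := h.der1 (hzm ν hν) 0
    have d2 := h.der2 (hzm ν hν) 0
    rw [h.zero _ (hzm ν hν)] at d1 d2
    have dW := ((d1.pow 2).div_const 2).sub (d2.const_mul (e : ℂ))
    have hof : HasDerivAt (fun t : ℝ => (t : ℂ)) 1 0 := by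
      exact (Complex.ofRealCLM.hasDerivAt (x := (0 : ℝ))).congr_deriv (by simp)
    have dE1 := (hof.const_mul (-2 * κ)).cexp
    have dE2 := (((((hof.const_mul κ).cexp).mul_const ν).const_mul (conj β)).const_add 1).pow 4
    have := dE1.mul (dE2.mul dW)
    refine this.congr_deriv ?_
    have w0 := hW0 ν hν
    rw [h.zero _ (hzm ν hν)] at w0
    simp only [Pi.mul_apply, Pi.sub_apply, Pi.pow_apply, mul_zero, Complex.ofReal_zero,
      Complex.exp_zero, one_mul, h.zero _ (hzm ν hν)]
    simp only [w0, mul_zero, zero_add]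
    simp only [hzz]
    ring
  have hR0 : ∀ ν : ℂ, ‖ν‖ < 1 → R 0 ν = 0 := by
    intro ν hν
    simp only [hR, hW0 ν hν, mul_zero]
  have hi : ‖Complex.I / 2‖ < 1 := by simp; norm_num
  have hi' : ‖-Complex.I / 2‖ < 1 := by simp; norm_num
  have ho : ‖(1 / 2 : ℂ)‖ < 1 := by norm_num
  have ho' : ‖(-1 / 2 : ℂ)‖ < 1 := by norm_num
  have hKd : ∃ L : ℝ, HasDerivAt K L 0 := by
    have := (((hRder _ ho).sub (hRder _ hi)).add (hRder _ ho')).sub (hRder _ hi')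
    have := Complex.reCLM.hasFDerivAt.comp_hasDerivAt (0 : ℝ) this
    refine ⟨_, this.congr_of_eventuallyEq (Eventually.of_forall fun t => ?_)⟩
    have := congrArg Complex.re (hKe t)
    simp only [Complex.ofReal_re] at this
    rw [← this]
    rfl
  obtain ⟨L, hL⟩ := hKd
  have hKz : K 0 = 0 := by
    have := hKe 0
    rw [hR0 _ ho, hR0 _ hi, hR0 _ ho', hR0 _ hi'] at this
    simp at this
    exact_mod_cast this.symm
  have hfin : ∀ ν : ℂ, ‖ν‖ < 1 → (1 + conj β * ν) ^ 4 * (M ν * (X (zz ν)).1 - e * (X (zz ν)).2) = 0 := by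
    intro ν hν
    set T := (1 + conj β * ν) ^ 4 * (M ν * (X (zz ν)).1 - e * (X (zz ν)).2) with hT
    have hu : ∀ u : ℂ, ‖u‖ = 1 → (u * T).re = 5 * L := by
      intro u hu
      have d1 := Complex.reCLM.hasFDerivAt.comp_hasDerivAt (0 : ℝ) ((hRder ν hν).const_mul u)
      have d2 := (hL.const_mul 5).sub d1
      have hmin : IsLocalMin ((fun t => 5 * K t) - (Complex.reCLM ∘ fun t => u * R t ν)) 0 := by
        refine Eventually.of_forall fun t => ?_
        simp only [Pi.sub_apply, Function.comp_apply, Complex.reCLM_apply, hKz, hR0 ν hν]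
        have h1 := hKb t ν (by simpa using hν)
        have h2 := Complex.re_le_norm (u * R t ν)
        rw [norm_mul, hu] at h2
        rw [mul_zero, mul_zero, Complex.zero_re]
        linarith
      have := hmin.hasDerivAt_eq_zero d2
      simp only [Complex.reCLM_apply] at this
      linarith
    have u1 := hu 1 (by simp)
    have u2 := hu (-1) (by simp)
    have u3 := hu Complex.I (by simp)
    have u4 := hu (-Complex.I) (by simp)
    apply Complex.ext <;> simp at u1 u2 u3 u4 ⊢ <;> linarith
  have hl' : ‖(l - β) / (1 - conj β * l)‖ < 1 := mobius_lt hβ1 hl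
  have hMl : M ((l - β) / (1 - conj β * l)) = l := by
    have h1 := hne _ hl'
    have h2 := mobius_ne hβ1 hl
    simp only [hM]
    rw [div_eq_iff h1]
    have hu := div_mul_cancel₀ (l - β) h2
    linear_combination hu
  have h3 := (mul_eq_zero.1 (hfin _ hl')).resolve_left (pow_ne_zero _ (hne _ hl'))
  simp only [hzz, hMl] at h3
  linear_combination (-(e : ℂ)) * h3 - (X (l, ((e / 2 : ℝ) : ℂ) * l ^ 2)).2 * hee

lemma OmFlow.X_zero {f X} (h : OmFlow f X) {b : ℂ × ℂ} (hb : b ∈ Om) (hXb : X b = 0) :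
    X (0, 0) = 0 := by
  have h1 : (X (0, 0)).2 = 0 := by
    have := h.stepD hb hXb (e := 1) (Or.inl rfl) (l := 0) (by simp)
    simpa using this
  have hd : ∀ e : ℝ, (e = 1 ∨ e = -1) → 
      fderiv ℂ (fun z => (X z).2) (0, 0) (1, 0) = e * (X (0, 0)).1 := by
    intro e he
    have hek : |e / 2| ≤ 1 / 2 := by rcases he with rfl | rfl <;> norm_num
    have d2 := disc_deriv (Y := fun z => (X z).2) h.Xhol.snd (e / 2)
    have d1 := disc_deriv (Y := fun z => (X z).1) h.Xhol.fst (e / 2)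
    have d3 := (((hasDerivAt_id (0 : ℂ)).const_mul (e : ℂ)).mul d1)
    have d4 := d3.congr_of_eventuallyEq (f₁ := fun l : ℂ => (X (l, (e / 2 : ℝ) * l ^ 2)).2) (by
      filter_upwards [ball_mem_nhds (0 : ℂ) one_pos] with l hl
      have := h.stepD hb hXb he (l := l) (by simpa using hl)
      simpa using this)
    rw [d2.unique d4]
    simp
  have a := hd 1 (Or.inl rfl)
  have b := hd (-1) (Or.inr rfl)
  have h0 : (X (0, 0)).1 = 0 := by
    push_cast at a b
    linear_combination (b - a) / 2
  exact Prod.ext h0 h1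

lemma AutPair.fix_zero {φ ψ} (h : AutPair φ ψ) : φ (0, 0) = (0, 0) := by
  refine h.zero_of_X Om_zero ?_
  have hb := h.mψ _ Om_zero
  refine h.flow.X_zero hb ?_
  simp only [h.r _ Om_zero]
  have : ((Complex.I * 0, 2 * Complex.I * 0) : ℂ × ℂ) = 0 := by simp
  rw [this, map_zero]


lemma ode_linear {G : ℂ → ℂ} (hG : DifferentiableOn ℂ G (ball 0 1))
    (hode : ∀ l ∈ ball (0 : ℂ) 1, l * deriv G l = G l) :
    ∀ l ∈ ball (0 : ℂ) 1, G l = deriv G 0 * l := by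
  have hG0 : G 0 = 0 := by
    have := hode 0 (by simp)
    simpa using this.symm
  set h := dslope G 0 with hh
  have hd : DifferentiableOn ℂ h (ball 0 1) :=
    (Complex.differentiableOn_dslope (ball_mem_nhds _ one_pos)).2 hG
  have hGl : ∀ l, G l = l * h l := by
    intro l
    have := sub_smul_dslope G 0 l
    simp [hG0] at this
    exact this.symm
  have hd' : DifferentiableOn ℂ (deriv h) (ball 0 1) := hd.deriv isOpen_ball
  have hz : ∀ l ∈ ball (0 : ℂ) 1, l ≠ 0 → deriv h l = 0 := by
    intro l hl hl0
    have h1 : HasDerivAt h (deriv h l) l :=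
      (hd.differentiableAt (isOpen_ball.mem_nhds hl)).hasDerivAt
    have h2 := (hasDerivAt_id l).mul h1
    have h3 : HasDerivAt G _ l := h2.congr_of_eventuallyEq (Eventually.of_forall hGl)
    have h4 := hode l hl
    rw [h3.deriv, hGl] at h4
    simp only [id, one_mul] at h4
    have : l ^ 2 * deriv h l = 0 := by linear_combination h4
    exact (mul_eq_zero.1 this).resolve_left (pow_ne_zero _ hl0)
  have hz' : ∀ l ∈ ball (0 : ℂ) 1, deriv h l = 0 := by
    intro l hl
    by_cases hl0 : l = 0
    · subst hl0
      have hc : ContinuousAt (deriv h) 0 := hd'.continuousOn.continuousAt (isOpen_ball.mem_nhds hl)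
      have h1 : Tendsto (deriv h) (𝓝[≠] 0) (𝓝 (deriv h 0)) := hc.tendsto.mono_left nhdsWithin_le_nhds
      refine tendsto_nhds_unique h1 (tendsto_const_nhds.congr' ?_)
      filter_upwards [self_mem_nhdsWithin, nhdsWithin_le_nhds (isOpen_ball.mem_nhds hl)] with x a b
      exact (hz x b a).symm
    · exact hz l hl hl0
  intro l hl
  have := isOpen_ball.is_const_of_deriv_eq_zero (convex_ball (0 : ℂ) 1).isPreconnected hd hz' hl
    (mem_ball_self one_pos)
  rw [hGl l, this, hh, dslope_same, mul_comm]

lemma AutPair.lin_ne {φ ψ} (h : AutPair φ ψ) :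
    fderiv ℂ (fun z => (ψ z).1) (0, 0) (1, 0) ≠ 0 := by
  intro hl1
  have hφ0 := h.fix_zero
  have hψ0 := h.symm.fix_zero
  have hσ : DifferentiableOn ℂ (fun z => (ψ z).1) Om := h.hψ.fst
  set C := fderiv ℂ (fun z => (ψ z).1) (0, 0) (0, 1) with hC
  set A := fderiv ℂ (fun z => (φ z).2) (0, 0) (1, 0) with hA
  have hCA : C * A = 1 := by
    have d1 := disc_deriv (Y := fun z => (φ z).1) h.hφ.fst 0
    have d2 := disc_deriv (Y := fun z => (φ z).2) h.hφ.snd 0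
    have d3 := d1.prodMk d2
    have e : HasFDerivAt (fun z => (ψ z).1) (fderiv ℂ (fun z => (ψ z).1) (0, 0))
        ((fun l : ℂ => ((φ (l, (0 : ℝ) * l ^ 2)).1, (φ (l, (0 : ℝ) * l ^ 2)).2)) 0) := by
      have : (fun l : ℂ => ((φ (l, (0 : ℝ) * l ^ 2)).1, (φ (l, (0 : ℝ) * l ^ 2)).2)) 0 = (0, 0) := by
        simp [hφ0]
      rw [this]
      exact (hσ.differentiableAt (Om_open.mem_nhds Om_zero)).hasFDerivAt
    have d4 := e.comp_hasDerivAt (0 : ℂ) d3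
    have d5 : HasDerivAt (fun l : ℂ => l) _ 0 := d4.congr_of_eventuallyEq (by
      filter_upwards [ball_mem_nhds (0 : ℂ) one_pos] with l hl
      simp only [Function.comp_apply, Prod.mk.eta]
      rw [h.l _ (Om_disc (by simpa using hl) (by norm_num))])
    have d6 := d5.unique (hasDerivAt_id 0)
    have e2 : (fderiv ℂ (fun z => (φ z).1) (0, 0) (1, 0), fderiv ℂ (fun z => (φ z).2) (0, 0) (1, 0))
      = (fderiv ℂ (fun z => (φ z).1) (0, 0) (1, 0)) • ((1 : ℂ), (0 : ℂ)) + A • ((0 : ℂ), (1 : ℂ)) := by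
      ext <;> simp [hA]
    rw [e2, map_add, map_smul, map_smul, hl1] at d6
    simp at d6
    rw [mul_comm]
    exact d6
  have hC1 : ‖C‖ ≤ 1 := by
    have hm : ∀ q ∈ ball (0 : ℂ) 1, ((0 : ℂ), q) ∈ Om := fun q hq => Om_of (by simpa using hq)
    have hd : DifferentiableOn ℂ (fun q : ℂ => (ψ (0, q)).1) (ball 0 1) :=
      hσ.comp (f := fun q : ℂ => ((0 : ℂ), q)) (by fun_prop) hm
    have hder : HasDerivAt (fun q : ℂ => (ψ (0, q)).1) C 0 := by
      have h1 : HasDerivAt (fun q : ℂ => ((0 : ℂ), q)) ((0 : ℂ), (1 : ℂ)) 0 :=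
        (hasDerivAt_const _ _).prodMk (hasDerivAt_id _)
      have h2 : HasFDerivAt (fun z => (ψ z).1) _ ((fun q : ℂ => ((0 : ℂ), q)) 0) := 
        (hσ.differentiableAt (Om_open.mem_nhds Om_zero)).hasFDerivAt
      exact h2.comp_hasDerivAt (0 : ℂ) h1
    rw [← hder.deriv]
    refine (Complex.norm_deriv_le_div_of_mapsTo_ball (R₂ := 1) hd ?_ one_pos).trans (by simp)
    intro q hq
    simp only [hψ0, mem_closedBall_zero_iff]
    exact (Om_fst (h.mψ _ (hm q hq))).le
  have hmaps : ∀ k : ℝ, |k| ≤ 1 / 2 → ∀ l ∈ ball (0 : ℂ) 1, φ (l, k * l ^ 2) = (0, A * l) := by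
    intro k hk
    have hmem : ∀ l ∈ ball (0 : ℂ) 1, φ (l, k * l ^ 2) ∈ Om :=
      fun l hl => h.mφ _ (Om_disc (by simpa using hl) hk)
    have hd2 := disc_diff (Y := fun z => (φ z).2) h.hφ.snd hk
    have hd1 := disc_diff (Y := fun z => (φ z).1) h.hφ.fst hk
    have hder := disc_deriv (Y := fun z => (φ z).2) h.hφ.snd k
    have hmt : MapsTo (fun l : ℂ => (φ (l, k * l ^ 2)).2) (ball 0 1)
        (closedBall ((fun l : ℂ => (φ (l, k * l ^ 2)).2) 0) 1) := by
      intro l hl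
      have : (φ (0, k * 0 ^ 2)).2 = 0 := by simp [hφ0]
      simp only [this, mem_closedBall_zero_iff]
      have := Om_snd (hmem l hl)
      nlinarith [sq_nonneg ‖(φ (l, k * l ^ 2)).1‖]
    have hA1 : ‖A‖ ≤ 1 := by
      rw [hA, ← hder.deriv]
      exact (Complex.norm_deriv_le_div_of_mapsTo_ball hd2 hmt one_pos).trans (by simp)
    have hA2 : ‖A‖ = 1 := by
      have : ‖C‖ * ‖A‖ = 1 := by rw [← norm_mul, hCA, norm_one]
      nlinarith [norm_nonneg A, norm_nonneg C]
    have haff := Complex.affine_of_mapsTo_ball_of_norm_dslope_eq_div hd2 hmt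
      (mem_ball_self one_pos) (by rw [dslope_same, hder.deriv, ← hA, hA2]; simp)
    have hq : ∀ l ∈ ball (0 : ℂ) 1, (φ (l, k * l ^ 2)).2 = A * l := by
      intro l hl
      have := haff hl
      simp only [dslope_same, hder.deriv] at this
      rw [this]
      simp [hφ0, hA, mul_comm]
    have hsm : ∀ ε > 0, ∃ r < (1 : ℝ), ∀ z : ℂ, r ≤ ‖z‖ → ‖z‖ < 1 → ‖(φ (z, k * z ^ 2)).1‖ ≤ ε := by
      intro ε hε
      refine ⟨1 - ε ^ 2 / 2, by nlinarith [sq_pos_of_pos hε], fun z hz1 hz2 => ?_⟩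
      have hzb : z ∈ ball (0 : ℂ) 1 := by simpa using hz2
      have h1 := Om_snd (hmem z hzb)
      rw [hq z hzb, norm_mul, hA2, one_mul] at h1
      refine (sq_le_sq₀ (norm_nonneg _) hε.le).1 ?_
      linarith
    obtain ⟨m1, hm1⟩ := const_of_im_small hd1 (by
      intro ε hε
      obtain ⟨r, hr, hb⟩ := hsm ε hε
      exact ⟨r, hr, fun z a b => (Complex.abs_im_le_norm _).trans (hb z a b)⟩)
    obtain ⟨m2, hm2⟩ := const_of_im_small (hd1.const_mul Complex.I) (by
      intro ε hε
      obtain ⟨r, hr, hb⟩ := hsm ε hε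
      refine ⟨r, hr, fun z a b => (Complex.abs_im_le_norm _).trans ?_⟩
      rw [norm_mul, Complex.norm_I, one_mul]
      exact hb z a b)
    intro l hl
    refine Prod.ext ?_ (hq l hl)
    have a := hm1 l hl
    have b := hm2 l hl
    rw [a] at b
    have : m1 = 0 := by
      have := congrArg Complex.im b
      simpa using this
    rw [a, this]; simp
  have hh : (1 / 2 : ℂ) ∈ ball (0 : ℂ) 1 := by simp; norm_num
  have a := hmaps 0 (by norm_num) (1 / 2) hh
  have b := hmaps (1 / 2) (by norm_num) (1 / 2) hh
  have c1 := h.l _ (Om_disc (l := 1 / 2) (k := 0) (by norm_num) (by norm_num))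
  have c2 := h.l _ (Om_disc (l := 1 / 2) (k := 1 / 2) (by norm_num) (by norm_num))
  rw [a] at c1
  rw [b, c1] at c2
  have := congrArg Prod.snd c2
  norm_num at this

lemma AutPair.fst_lin {φ ψ} (h : AutPair φ ψ) : ∃ a : ℂ, ∀ z ∈ Om, (ψ z).1 = a * z.1 := by
  have hφ0 := h.fix_zero
  have hσ : DifferentiableOn ℂ (fun z => (ψ z).1) Om := h.hψ.fst
  set a := fderiv ℂ (fun z => (ψ z).1) (0, 0) (1, 0) with ha
  have ha0 : a ≠ 0 := h.lin_ne
  obtain ⟨c, -, hX⟩ := h.flow.stepA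
  have hX0 : fderiv ℂ ψ (φ (0, 0)) (Complex.I * (φ (0, 0)).1, 2 * Complex.I * (φ (0, 0)).2) = 0 := by
    have : ((Complex.I * 0, 2 * Complex.I * 0) : ℂ × ℂ) = 0 := by simp
    rw [hφ0, this, map_zero]
  rw [hX0] at hX
  have hEul : ∀ w ∈ Om, fderiv ℂ (fun z => (ψ z).1) w (Complex.I * w.1, 2 * Complex.I * w.2)
      = c * (ψ w).1 := by
    intro w hw
    have := hX (ψ w) (h.mψ w hw)
    rw [h.r w hw] at this
    have hd : DifferentiableAt ℂ ψ w := h.hψ.differentiableAt (Om_open.mem_nhds hw)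
    rw [fderiv.fst hd]
    simpa using this
  have hG : ∀ k : ℝ, |k| ≤ 1 / 2 → ∀ l ∈ ball (0 : ℂ) 1,
      Complex.I * (l * deriv (fun l : ℂ => (ψ (l, k * l ^ 2)).1) l) = c * (ψ (l, k * l ^ 2)).1 := by
    intro k hk l hl
    have hw := Om_disc (l := l) (by simpa using hl) hk
    have h1 : HasDerivAt (fun l : ℂ => (l, (k : ℂ) * l ^ 2)) ((1 : ℂ), k * (2 * l)) l := by
      have := (hasDerivAt_id l).prodMk (((hasDerivAt_id l).pow 2).const_mul (k : ℂ))
      refine this.congr_deriv ?_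
      simp
    have h2 : HasFDerivAt (fun z => (ψ z).1) _ ((fun l : ℂ => (l, (k : ℂ) * l ^ 2)) l) :=
      (hσ.differentiableAt (Om_open.mem_nhds hw)).hasFDerivAt
    have h3 : HasDerivAt (fun l : ℂ => (ψ (l, k * l ^ 2)).1)
        (fderiv ℂ (fun z => (ψ z).1) (l, k * l ^ 2) ((1 : ℂ), k * (2 * l))) l := by
      have := h2.comp_hasDerivAt l h1
      exact this
    rw [h3.deriv, ← hEul _ hw, ← smul_eq_mul l, ← map_smul, ← smul_eq_mul Complex.I, ← map_smul]
    congr 1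
    ext
    · simp
    · simp; ring
  have hc : c = Complex.I := by
    have hd := disc_diff hσ (k := 0) (by norm_num)
    have hder := disc_deriv hσ 0
    have hd' := hd.deriv isOpen_ball
    have h1 := ((hasDerivAt_id (0 : ℂ)).mul
      (hd'.differentiableAt (ball_mem_nhds _ one_pos)).hasDerivAt).const_mul Complex.I
    have h2 := hder.const_mul c
    have h3 := h2.congr_of_eventuallyEq (f₁ := fun l : ℂ => Complex.I * (l * deriv (fun l : ℂ =>
      (ψ (l, (0 : ℝ) * l ^ 2)).1) l)) (by
        filter_upwards [ball_mem_nhds (0 : ℂ) one_pos] with l hl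
        exact hG 0 (by norm_num) l hl)
    have h4 := h1.unique h3
    rw [hder.deriv] at h4
    simp only [id, zero_mul, add_zero, one_mul] at h4
    exact (mul_right_cancel₀ ha0 h4).symm
  refine ⟨a, fun z hz => ?_⟩
  refine sub_eq_zero.1 (lemma_U (Y := fun z => (ψ z).1 - a * z.1) (hσ.sub (by fun_prop)) ?_ z hz)
  intro l hl k hk
  have := ode_linear (disc_diff hσ hk) (fun l hl => by
    have := hG k hk l hl
    rw [hc] at this
    exact mul_left_cancel₀ Complex.I_ne_zero this) l (by simpa using hl)
  rw [(disc_deriv hσ k).deriv] at this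
  simp only at this ⊢
  rw [this, sub_self]

lemma AutPair.lin_le {φ ψ} (h : AutPair φ ψ) {a : ℂ} (ha : ∀ z ∈ Om, (ψ z).1 = a * z.1) :
    ‖a‖ ≤ 1 := by
  have hc : Tendsto (fun r : ℝ => ‖a‖ * r) (𝓝[<] 1) (𝓝 (‖a‖ * 1)) :=
    ((continuous_const.mul continuous_id).tendsto 1).mono_left nhdsWithin_le_nhds
  rw [mul_one] at hc
  refine le_of_tendsto hc ?_
  filter_upwards [Ioo_mem_nhdsLT (show (0 : ℝ) < 1 by norm_num)] with r hr
  have hm := Om_disc (l := (r : ℂ)) (k := 0) (by simp [abs_of_pos hr.1, hr.2]) (by norm_num)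
  have h1 := Om_fst (h.mψ _ hm)
  rw [ha _ hm, norm_mul, Complex.norm_real, Real.norm_of_nonneg hr.1.le] at h1
  exact h1.le

lemma AutPair.fst_rot {φ ψ} (h : AutPair φ ψ) :
    ∃ ζ : ℂ, ‖ζ‖ = 1 ∧ ∀ z ∈ Om, (φ z).1 = ζ * z.1 := by
  obtain ⟨a, ha⟩ := h.fst_lin
  obtain ⟨b, hb⟩ := h.symm.fst_lin
  have ha1 := h.lin_le ha
  have hb1 := h.symm.lin_le hb
  have hm := Om_disc (l := 1 / 2) (k := 0) (by norm_num) (by norm_num)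
  have h1 := ha _ (h.mφ _ hm)
  rw [h.l _ hm, hb _ hm] at h1
  have hab : a * b = 1 := by
    simp only at h1
    linear_combination (-2) * h1
  refine ⟨b, ?_, hb⟩
  have : ‖a‖ * ‖b‖ = 1 := by rw [← norm_mul, hab, norm_one]
  nlinarith [norm_nonneg a, norm_nonneg b]


open ComplexConjugate in
lemma fiber_disc {Q : ℂ × ℂ → ℂ} (hQ : DifferentiableOn ℂ Q Om)
    (hm : ∀ z ∈ Om, (z.1, Q z) ∈ Om) (hQ0 : Q (0, 0) = 0) {k : ℝ} (hk : |k| ≤ 1 / 2) :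
    ∃ κ : ℝ, (∀ l ∈ ball (0 : ℂ) 1, Q (l, k * l ^ 2) = fderiv ℂ Q (0, 0) (1, 0) * l + κ * l ^ 2
      + conj (fderiv ℂ Q (0, 0) (1, 0)) * l ^ 3) ∧
      ∀ ω : ℂ, ‖ω‖ = 1 → |κ + 2 * (fderiv ℂ Q (0, 0) (1, 0) * conj ω).re| ≤ 1 / 2 := by
  have hmem : ∀ l ∈ ball (0 : ℂ) 1, (l, Q (l, k * l ^ 2)) ∈ Om :=
    fun l hl => hm _ (Om_disc (by simpa using hl) hk)
  have hd := disc_diff hQ hk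
  have hder := disc_deriv hQ k
  set c := fderiv ℂ Q (0, 0) (1, 0) with hc
  have hll : ∀ l : ℂ, l ^ 2 / 2 * conj l ^ 2 = ((‖l‖ ^ 4 / 2 : ℝ) : ℂ) := by
    intro l
    have : l * conj l = ((‖l‖ ^ 2 : ℝ) : ℂ) := by
      rw [Complex.mul_conj, Complex.normSq_eq_norm_sq]
    push_cast at this ⊢
    linear_combination ((l * conj l + (‖l‖ : ℂ) ^ 2) / 2) * this
  obtain ⟨κ, hκ⟩ := section_form hd (C := 8) (by
    intro l hl
    have h1 := Om_W (hmem l hl) (e := 1) (Or.inl rfl)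
    have hl1 : ‖l‖ < 1 := by simpa using hl
    set G := Q (l, k * l ^ 2) with hG
    have hG1 : 2 * ‖G‖ + ‖l‖ ^ 2 < 2 := Om_snd (hmem l hl)
    set x := (l ^ 2 / 2 - 1 * G) * conj l ^ 2 with hx
    have hxi : (G * conj l ^ 2).im = - x.im := by
      have : x = ((‖l‖ ^ 4 / 2 : ℝ) : ℂ) - G * conj l ^ 2 := by rw [← hll, hx]; ring
      rw [this, Complex.sub_im, Complex.ofReal_im]; ring
    have hxn : ‖x‖ ≤ 2 := by
      rw [hx, norm_mul, norm_pow, RCLike.norm_conj]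
      have a1 : ‖l ^ 2 / 2 - 1 * G‖ ≤ 2 := by
        have := norm_sub_le (l ^ 2 / 2) (1 * G)
        rw [one_mul] at *
        have h3 : ‖l ^ 2 / 2‖ = ‖l‖ ^ 2 / 2 := by simp
        nlinarith [norm_nonneg l, norm_nonneg G]
      calc ‖l ^ 2 / 2 - 1 * G‖ * ‖l‖ ^ 2 ≤ 2 * 1 ^ 2 := by gcongr
        _ = 2 := by norm_num
    have h2 : x.im ^ 2 = (‖x‖ - x.re) * (‖x‖ + x.re) := by
      have : ‖x‖ ^ 2 = x.re ^ 2 + x.im ^ 2 := by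
        rw [← Complex.normSq_eq_norm_sq, Complex.normSq_apply]; ring
      linarith
    change ((G * conj l ^ 2).im) ^ 2 ≤ _
    rw [hxi, neg_sq, h2]
    have h3 : 0 ≤ ‖x‖ + x.re := by linarith [neg_le_abs x.re, Complex.abs_re_le_norm x]
    have h4 : ‖x‖ + x.re ≤ 4 := by linarith [Complex.re_le_norm x]
    have h5 : 0 ≤ 1 - ‖l‖ ^ 2 := by nlinarith [norm_nonneg l]
    calc (‖x‖ - x.re) * (‖x‖ + x.re) ≤ (2 * (1 - ‖l‖ ^ 2)) * 4 :=
          mul_le_mul h1 h4 h3 (by positivity)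
      _ = 8 * (1 - ‖l‖ ^ 2) := by ring)
  have hf : ∀ l ∈ ball (0 : ℂ) 1, Q (l, k * l ^ 2) = c * l + κ * l ^ 2 + conj c * l ^ 3 := by
    intro l hl
    have := hκ l hl
    rw [hder.deriv] at this
    simp only [ne_eq, OfNat.ofNat_ne_zero, not_false_eq_true, zero_pow, mul_zero, hQ0, zero_add,
      map_zero, zero_mul, add_zero] at this
    exact this
  refine ⟨κ, hf, ?_⟩
  intro ω hω
  have hωω : ω * conj ω = 1 := by
    rw [Complex.mul_conj, Complex.normSq_eq_norm_sq, hω]; simp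
  have key : ∀ e : ℝ, (e = 1 ∨ e = -1) → 0 ≤ 1 / 2 - e * (κ + 2 * (c * conj ω).re) := by
    intro e he
    have hec : (e : ℂ) = 1 ∨ (e : ℂ) = -1 := by rcases he with rfl | rfl <;> simp
    have hcont : Continuous (fun r : ℝ => (((r * ω : ℂ) ^ 2 / 2 - e * (c * (r * ω) + κ * (r * ω) ^ 2 +
      conj c * (r * ω) ^ 3)) * conj (r * ω) ^ 2).re + 2 * (1 - r ^ 2)) := by fun_prop
    have ht := (hcont.tendsto 1).mono_left (nhdsWithin_le_nhds (s := Iio 1))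
    have hge := ge_of_tendsto (b := 0) ht (by
      filter_upwards [Ioo_mem_nhdsLT (show (0 : ℝ) < 1 by norm_num)] with r hr
      have hn : ‖(r * ω : ℂ)‖ = r := by simp [hω, abs_of_pos hr.1]
      have hmm : (r * ω : ℂ) ∈ ball (0 : ℂ) 1 := by rw [mem_ball_zero_iff, hn]; exact hr.2
      have := Om_W (hmem _ hmm) hec
      rw [hf _ hmm, hn] at this
      linarith [norm_nonneg (((r * ω : ℂ) ^ 2 / 2 - e * (c * (r * ω) + κ * (r * ω) ^ 2 +
        conj c * (r * ω) ^ 3)) * conj (r * ω) ^ 2)])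
    have e1 : (ω ^ 2 / 2 - e * (c * ω + κ * ω ^ 2 + conj c * ω ^ 3)) * conj ω ^ 2
        = ((1 / 2 : ℝ) : ℂ) - e * (κ + (c * conj ω + conj (c * conj ω))) := by
      simp only [map_mul, Complex.conj_conj]
      push_cast
      linear_combination ((ω * conj ω + 1) / 2 - e * (c * conj ω + κ * (ω * conj ω + 1) +
        conj c * ω * (ω * conj ω + 1))) * hωω
    simp only [Complex.ofReal_one, one_mul, one_pow, sub_self, mul_zero, add_zero] at hge
    rw [e1] at hge
    simp only [Complex.sub_re, Complex.ofReal_re, Complex.re_ofReal_mul, Complex.add_re,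
      Complex.conj_re] at hge
    linarith
  have k1 := key 1 (Or.inl rfl)
  have k2 := key (-1) (Or.inr rfl)
  rw [abs_le]
  constructor <;> linarith

open ComplexConjugate in
lemma fiber_form {Q : ℂ × ℂ → ℂ} (hQ : DifferentiableOn ℂ Q Om)
    (hm : ∀ z ∈ Om, (z.1, Q z) ∈ Om) (hQ0 : Q (0, 0) = 0)
    (hsurj : ∀ q : ℂ, ‖q‖ < 1 → ∃ q' : ℂ, ((0 : ℂ), q') ∈ Om ∧ Q (0, q') = q) :
    ∃ δ : ℝ, (δ = 1 ∨ δ = -1) ∧ ∀ z ∈ Om, Q z = δ * z.2 := by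
  have hdisc : ∀ k : ℝ, ∃ κ : ℝ, |k| ≤ 1 / 2 → _ := fun k => by
    by_cases hk : |k| ≤ 1 / 2
    · obtain ⟨κ, h⟩ := fiber_disc hQ hm hQ0 hk
      exact ⟨κ, fun _ => h⟩
    · exact ⟨0, fun h => absurd h hk⟩
  choose κ hκ using hdisc
  set c := fderiv ℂ Q (0, 0) (1, 0) with hc
  set B : ℝ := 1 + 2 * ‖c‖ with hB
  have hB0 : 0 < B := by positivity
  set δ : ℝ := 2 * (κ (1 / 2) - κ 0) with hδ
  have haff : ∀ k : ℝ, |k| ≤ 1 / 2 → κ k = κ 0 + δ * k := by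
    intro k hk
    by_cases hk0 : k = 0
    · simp [hk0]
    have hest : ∀ r : ℝ, 0 < r → r < 1 / 2 → |(κ k - κ 0) / k - δ| ≤ 16 * B * r ^ 2 := by
      intro r hr0 hr1
      set ρ : ℝ := 1 / r ^ 2 - 1 with hρ
      have hr2 : 0 < r ^ 2 := by positivity
      have hr4 : r ^ 2 < 1 / 4 := by nlinarith
      have hρr : ρ * r ^ 2 = 1 - r ^ 2 := by rw [hρ]; field_simp
      have hρ2 : 1 / 2 ≤ ρ * r ^ 2 := by linarith
      have hρ0 : 0 < ρ := by
        by_contra hcon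
        nlinarith
      have hρ3 : 1 ≤ ρ := by
        by_contra hcon
        nlinarith
      have hmr : ∀ x ∈ ball (0 : ℂ) ρ, ((r : ℂ), x * r ^ 2) ∈ Om := by
        intro x hx
        rw [mem_ball_zero_iff] at hx
        apply Om_of
        rw [norm_mul, norm_pow, Complex.norm_real, Real.norm_of_nonneg hr0.le]
        nlinarith
      set g : ℂ → ℂ := fun x => (Q (r, x * r ^ 2) - c * r - conj c * r ^ 3) / r ^ 2 with hg
      have hrc : (r : ℂ) ≠ 0 := by exact_mod_cast hr0.ne'
      have hgd : DifferentiableOn ℂ g (ball 0 ρ) := by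
        refine DifferentiableOn.div_const (DifferentiableOn.sub_const (DifferentiableOn.sub_const ?_ _)
          _) _
        exact hQ.comp (f := fun x : ℂ => ((r : ℂ), x * (r : ℂ) ^ 2)) (by fun_prop) hmr
      have hgκ : ∀ k : ℝ, |k| ≤ 1 / 2 → g k = κ k := by
        intro k hk
        simp only [hg]
        rw [(hκ k hk).1 r (by simp [abs_of_pos hr0]; linarith)]
        field_simp
        ring
      have hgb : ∀ x ∈ ball (0 : ℂ) ρ, ‖g x‖ ≤ B / r ^ 2 := by
        intro x hx
        simp only [hg]
        rw [norm_div, norm_pow, Complex.norm_real, Real.norm_of_nonneg hr0.le]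
        gcongr
        have h1 : 2 * ‖Q (r, x * r ^ 2)‖ + ‖(r : ℂ)‖ ^ 2 < 2 := Om_snd (hm _ (hmr x hx))
        have h2 := norm_sub_le (Q (r, x * r ^ 2) - c * r) (conj c * r ^ 3)
        have h3 := norm_sub_le (Q (r, x * r ^ 2)) (c * r)
        simp only [norm_mul, norm_pow, RCLike.norm_conj, Complex.norm_real,
          Real.norm_of_nonneg hr0.le] at h1 h2 h3
        have h4 : ‖c‖ * r ≤ ‖c‖ * 1 := by gcongr; linarith
        have h5 : ‖c‖ * r ^ 3 ≤ ‖c‖ * 1 := by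
          gcongr
          exact pow_le_one₀ hr0.le (by linarith)
        nlinarith
      have h00 : (0 : ℂ) ∈ ball (0 : ℂ) ρ := mem_ball_self hρ0
      have hFd : DifferentiableOn ℂ (dslope g 0) (ball 0 ρ) :=
        (Complex.differentiableOn_dslope (ball_mem_nhds _ hρ0)).2 hgd
      have hFb : ∀ x ∈ ball (0 : ℂ) ρ, ‖dslope g 0 x‖ ≤ 4 * B := by
        intro x hx
        have hmt : MapsTo g (ball 0 ρ) (closedBall (g 0) (2 * B / r ^ 2)) := by
          intro y hy
          rw [mem_closedBall, dist_eq_norm]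
          have := norm_sub_le (g y) (g 0)
          have a1 := hgb y hy
          have a2 := hgb 0 h00
          have : 2 * B / r ^ 2 = B / r ^ 2 + B / r ^ 2 := by ring
          linarith
        refine (Complex.norm_dslope_le_div_of_mapsTo_ball hgd hmt hx).trans ?_
        rw [div_div, div_le_iff₀ (by positivity)]
        nlinarith
      have hFl : ∀ x ∈ ball (0 : ℂ) ρ, ‖dslope g 0 x - dslope g 0 0‖ ≤ 16 * B * r ^ 2 * ‖x‖ := by
        intro x hx
        have hmt : MapsTo (dslope g 0) (ball 0 ρ) (closedBall (dslope g 0 0) (8 * B)) := by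
          intro y hy
          rw [mem_closedBall, dist_eq_norm]
          have := norm_sub_le (dslope g 0 y) (dslope g 0 0)
          linarith [hFb y hy, hFb 0 h00]
        have := Complex.dist_le_div_mul_dist_of_mapsTo_ball hFd hmt hx
        rw [dist_eq_norm, dist_zero_right] at this
        refine this.trans ?_
        gcongr
        rw [div_le_iff₀ hρ0]
        nlinarith
      have hkb : ∀ k : ℝ, |k| ≤ 1 / 2 → (k : ℂ) ∈ ball (0 : ℂ) ρ := by
        intro k hk
        rw [mem_ball_zero_iff, Complex.norm_real, Real.norm_eq_abs]
        linarith
      have hFk : ∀ k : ℝ, |k| ≤ 1 / 2 → k ≠ 0 → dslope g 0 k = (((κ k - κ 0) / k : ℝ) : ℂ) := by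
        intro k hk hk0
        have hkc : (k : ℂ) ≠ 0 := by exact_mod_cast hk0
        rw [dslope_of_ne _ hkc, slope_def_field, hgκ k hk]
        have := hgκ 0 (by norm_num)
        rw [Complex.ofReal_zero] at this
        rw [this]
        push_cast
        simp
      have a1 := hFl k (hkb k hk)
      have a2 := hFl (1 / 2 : ℝ) (hkb _ (by norm_num))
      rw [hFk k hk hk0] at a1
      rw [hFk (1 / 2) (by norm_num) (by norm_num)] at a2
      have e1 : (κ (1 / 2) - κ 0) / (1 / 2) = δ := by rw [hδ]; ring
      rw [e1] at a2
      have a3 := norm_sub_le ((((κ k - κ 0) / k : ℝ) : ℂ) - dslope g 0 0) ((δ : ℂ) - dslope g 0 0)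
      have e2 : ((((κ k - κ 0) / k : ℝ) : ℂ) - dslope g 0 0) - ((δ : ℂ) - dslope g 0 0)
        = (((κ k - κ 0) / k - δ : ℝ) : ℂ) := by push_cast; ring
      rw [e2, Complex.norm_real, Real.norm_eq_abs] at a3
      rw [Complex.norm_real, Real.norm_eq_abs] at a1 a2
      have b1 : 16 * B * r ^ 2 * |k| ≤ 16 * B * r ^ 2 * (1 / 2) := by gcongr
      have b2 : |(1 / 2 : ℝ)| = 1 / 2 := by norm_num
      rw [b2] at a2
      linarith
    have hz : |(κ k - κ 0) / k - δ| ≤ 0 := by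
      have hcont : Continuous (fun r : ℝ => 16 * B * r ^ 2) := by fun_prop
      have ht := (hcont.tendsto 0).mono_left (nhdsWithin_le_nhds (s := Ioi 0))
      simp only [ne_eq, OfNat.ofNat_ne_zero, not_false_eq_true, zero_pow, mul_zero] at ht
      refine ge_of_tendsto ht ?_
      filter_upwards [Ioo_mem_nhdsGT (show (0 : ℝ) < 1 / 2 by norm_num)] with r hr
      exact hest r hr.1 hr.2
    have := abs_eq_zero.1 (le_antisymm hz (abs_nonneg _))
    field_simp at this
    linarith
  have hform : ∀ z ∈ Om, Q z = c * z.1 + κ 0 * z.1 ^ 2 + δ * z.2 + conj c * z.1 ^ 3 := by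
    intro z hz
    refine sub_eq_zero.1 (lemma_U (Y := fun z => Q z - (c * z.1 + κ 0 * z.1 ^ 2 + δ * z.2 +
      conj c * z.1 ^ 3)) (hQ.sub (by fun_prop)) ?_ z hz)
    intro l hl k hk
    simp only
    rw [(hκ k hk).1 l (by simpa using hl), haff k hk]
    push_cast
    ring
  have hδ1 : 1 ≤ |δ| := by
    by_contra hcon
    push Not at hcon
    obtain ⟨q, hq1, hq2⟩ := hsurj (((1 + |δ|) / 2 : ℝ) : ℂ) (by
      rw [Complex.norm_real, Real.norm_of_nonneg (by positivity)]; linarith)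
    rw [hform _ hq1] at hq2
    have h1 : 2 * ‖q‖ + ‖(0 : ℂ)‖ ^ 2 < 2 := Om_snd hq1
    have h2 := congrArg norm hq2
    simp only [mul_zero, zero_add, ne_eq, OfNat.ofNat_ne_zero, not_false_eq_true, zero_pow, add_zero]
      at h2
    rw [norm_mul, Complex.norm_real, Complex.norm_real, Real.norm_eq_abs,
      Real.norm_of_nonneg (by positivity)] at h2
    simp at h1
    nlinarith [abs_nonneg δ]
  have hδ2 : 1 ≤ δ ^ 2 := by
    rw [← sq_abs]; nlinarith
  have hx : ∀ ω : ℂ, ‖ω‖ = 1 → κ 0 + 2 * (c * conj ω).re = 0 ∧ δ ^ 2 ≤ 1 := by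
    intro ω hω
    have h1 := (hκ (1 / 2) (by norm_num)).2 ω hω
    have h2 := (hκ (-1 / 2) (by norm_num)).2 ω hω
    rw [haff _ (by norm_num)] at h1 h2
    set x := κ 0 + 2 * (c * conj ω).re with hx
    have h1' : (x + δ / 2) ^ 2 ≤ (1 / 2) ^ 2 := by
      apply sq_le_sq'  <;> [have := (abs_le.1 h1).1; have := (abs_le.1 h1).2] <;> linarith
    have h2' : (x - δ / 2) ^ 2 ≤ (1 / 2) ^ 2 := by
      apply sq_le_sq'  <;> [have := (abs_le.1 h2).1; have := (abs_le.1 h2).2] <;> linarith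
    constructor
    · have : x ^ 2 ≤ 0 := by nlinarith
      exact pow_eq_zero_iff two_ne_zero |>.1 (le_antisymm this (sq_nonneg x))
    · nlinarith [sq_nonneg x]
  have x1 := (hx 1 (by simp)).1
  have x2 := (hx (-1) (by simp)).1
  have x3 := (hx Complex.I (by simp)).1
  simp at x1 x2 x3
  have hk0 : κ 0 = 0 := by linarith
  have hc0 : c = 0 := by
    apply Complex.ext <;> simp <;> linarith
  refine ⟨δ, ?_, ?_⟩
  · have : δ ^ 2 = 1 := le_antisymm (hx 1 (by simp)).2 hδ2
    have h0 : (δ - 1) * (δ + 1) = 0 := by nlinarith [this]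
    rcases mul_eq_zero.1 h0 with h | h
    · left; linarith
    · right; linarith
  · intro z hz
    rw [hform z hz, hk0, hc0]
    simp

lemma AutPair.form {φ ψ} (h : AutPair φ ψ) :
    ∃ ζ : ℂ, ‖ζ‖ = 1 ∧ ∃ δ : ℝ, (δ = 1 ∨ δ = -1) ∧ ∀ z ∈ Om, φ z = (ζ * z.1, ζ ^ 2 * (δ * z.2)) := by
  obtain ⟨ζ, hζ, h1⟩ := h.fst_rot
  have hζ0 : ζ ≠ 0 := by
    rintro rfl
    simp at hζ
  have hφ0 := h.fix_zero
  obtain ⟨δ, hδ, hQ⟩ := fiber_form (Q := fun z => ζ⁻¹ ^ 2 * (φ z).2) (h.hφ.snd.const_mul _) (by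
      intro z hz
      have := Om_scale (h.mφ z hz) (l := ζ⁻¹) (by simp [hζ])
      rw [h1 z hz, inv_mul_cancel_left₀ hζ0] at this
      exact this) (by simp [hφ0]) (by
      intro q hq
      have hmem : ((0 : ℂ), ζ ^ 2 * q) ∈ Om := Om_of (by simpa [hζ] using hq)
      have h2 := h.r _ hmem
      have h3 := h1 _ (h.mψ _ hmem)
      rw [h2] at h3
      have h4 : (ψ (0, ζ ^ 2 * q)).1 = 0 := by
        rcases mul_eq_zero.1 h3.symm with h | h
        · exact absurd h hζ0
        · exact h
      have h5 : ((0 : ℂ), (ψ (0, ζ ^ 2 * q)).2) = ψ (0, ζ ^ 2 * q) := Prod.ext h4.symm rfl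
      refine ⟨(ψ (0, ζ ^ 2 * q)).2, ?_, ?_⟩
      · rw [h5]; exact h.mψ _ hmem
      · simp only [h5, h2]
        field_simp)
  refine ⟨ζ, hζ, δ, hδ, fun z hz => Prod.ext (h1 z hz) ?_⟩
  have := hQ z hz
  simp only at this ⊢
  rw [← this]
  field_simp


/-- coordinates to the model -/
noncomputable def toOm (z : Fin 2 → ℂ) : ℂ × ℂ := (z 0, 4 * z 1 - z 0 ^ 2 / 2)

/-- coordinates from the model -/
noncomputable def ofOm (z : ℂ × ℂ) : Fin 2 → ℂ := ![z.1, (z.2 + z.1 ^ 2 / 2) / 4]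

lemma ofOm_toOm (z : Fin 2 → ℂ) : ofOm (toOm z) = z := by
  funext i
  fin_cases i
  · simp [ofOm, toOm]
  · simp [ofOm, toOm]

lemma toOm_ofOm (z : ℂ × ℂ) : toOm (ofOm z) = z := by
  apply Prod.ext
  · simp [ofOm, toOm]
  · simp [ofOm, toOm]
    ring

lemma toOm_diff : Differentiable ℂ toOm := by
  unfold toOm
  fun_prop

lemma ofOm_diff : Differentiable ℂ ofOm := by
  rw [differentiable_pi]
  intro i
  fin_cases i
  · simp only [ofOm]; simp
  · simp only [ofOm]; simp; fun_prop

lemma piMap_two (w : Fin 2 → ℂ) : piMap 2 w = ![w 0 + w 1, w 0 * w 1] := by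
  have h2 : Finset.powersetCard 2 (Finset.univ : Finset (Fin 2)) = {Finset.univ} := by decide
  funext i
  fin_cases i
  · simp [piMap, Finset.powersetCard_one]
  · simp [piMap, h2]

lemma ell_two (w : Fin 2 → ℂ) : w ∈ ellipsoid (1 / 2) 2 ↔ ‖w 0‖ + ‖w 1‖ < 1 := by
  simp [ellipsoid]

lemma norm_key (a b : ℂ) : (a + b, 4 * (a * b) - (a + b) ^ 2 / 2) ∈ Om ↔ ‖a‖ + ‖b‖ < 1 := by
  rw [Om_mem]
  have e1 : 4 * (a * b) - (a + b) ^ 2 / 2 + (a + b) ^ 2 / 2 = 4 * (a * b) := by ring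
  have e2 : 4 * (a * b) - (a + b) ^ 2 / 2 - (a + b) ^ 2 / 2 = - (a - b) ^ 2 := by ring
  rw [e1, e2, norm_neg, norm_pow, norm_mul, norm_mul]
  have h := parallelogram_law_with_norm ℝ a b
  have h4 : ‖(4 : ℂ)‖ = 4 := by simp
  rw [h4]
  have e3 : ‖a + b‖ ^ 2 + 4 * (‖a‖ * ‖b‖) + ‖a - b‖ ^ 2 = 2 * (‖a‖ + ‖b‖) ^ 2 := by
    linarith
  rw [e3]
  constructor
  · intro h
    nlinarith [norm_nonneg a, norm_nonneg b]
  · intro h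
    nlinarith [norm_nonneg a, norm_nonneg b]

lemma mem_sym (z : Fin 2 → ℂ) : z ∈ symEllipsoid (1 / 2) 2 ↔ toOm z ∈ Om := by
  constructor
  · rintro ⟨w, hw, rfl⟩
    rw [piMap_two]
    rw [ell_two] at hw
    have := (norm_key (w 0) (w 1)).2 hw
    simpa [toOm] using this
  · intro hz
    obtain ⟨r, hr⟩ := IsAlgClosed.exists_pow_nat_eq (z 0 ^ 2 - 4 * z 1) (n := 2) (by norm_num)
    have e1 : (z 0 + r) / 2 + (z 0 - r) / 2 = z 0 := by ring
    have e2 : (z 0 + r) / 2 * ((z 0 - r) / 2) = z 1 := by linear_combination (-1 / 4) * hr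
    refine ⟨![(z 0 + r) / 2, (z 0 - r) / 2], ?_, ?_⟩
    · rw [ell_two]
      have := (norm_key ((z 0 + r) / 2) ((z 0 - r) / 2)).1 (by rw [e1, e2]; exact hz)
      simpa using this
    · rw [piMap_two]
      funext i
      fin_cases i
      · simpa using e1
      · simpa using e2

lemma mem_sym_ofOm (z : ℂ × ℂ) : ofOm z ∈ symEllipsoid (1 / 2) 2 ↔ z ∈ Om := by
  rw [mem_sym, toOm_ofOm]

lemma conj_pair {φ ψ : (Fin 2 → ℂ) → (Fin 2 → ℂ)}
    (hφ : DifferentiableOn ℂ φ (symEllipsoid (1 / 2) 2))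
    (hψ : DifferentiableOn ℂ ψ (symEllipsoid (1 / 2) 2))
    (mφ : MapsTo φ (symEllipsoid (1 / 2) 2) (symEllipsoid (1 / 2) 2))
    (mψ : MapsTo ψ (symEllipsoid (1 / 2) 2) (symEllipsoid (1 / 2) 2))
    (hi : InvOn ψ φ (symEllipsoid (1 / 2) 2) (symEllipsoid (1 / 2) 2)) :
    AutPair (fun z => toOm (φ (ofOm z))) (fun z => toOm (ψ (ofOm z))) where
  hφ := toOm_diff.comp_differentiableOn
    (hφ.comp ofOm_diff.differentiableOn (fun z hz => (mem_sym_ofOm z).2 hz))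
  hψ := toOm_diff.comp_differentiableOn
    (hψ.comp ofOm_diff.differentiableOn (fun z hz => (mem_sym_ofOm z).2 hz))
  mφ z hz := (mem_sym _).1 (mφ ((mem_sym_ofOm z).2 hz))
  mψ z hz := (mem_sym _).1 (mψ ((mem_sym_ofOm z).2 hz))
  l z hz := by
    simp only [ofOm_toOm]
    rw [hi.1 ((mem_sym_ofOm z).2 hz), toOm_ofOm]
  r z hz := by
    simp only [ofOm_toOm]
    rw [hi.2 ((mem_sym_ofOm z).2 hz), toOm_ofOm]

/-- the two families of maps -/
noncomputable def stdMap (ζ : ℂ) (δ : ℝ) (z : Fin 2 → ℂ) : Fin 2 → ℂ :=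
  ofOm (ζ * (toOm z).1, ζ ^ 2 * (δ * (toOm z).2))

lemma stdMap_one (ζ : ℂ) (z : Fin 2 → ℂ) : stdMap ζ 1 z = ![ζ * z 0, ζ ^ 2 * z 1] := by
  funext i
  fin_cases i
  · simp [stdMap, ofOm, toOm]
  · simp [stdMap, ofOm, toOm]
    ring

lemma stdMap_neg_one (ζ : ℂ) (z : Fin 2 → ℂ) :
    stdMap ζ (-1) z = ![ζ * z 0, ζ ^ 2 * (z 0 ^ 2 / 4 - z 1)] := by
  funext i
  fin_cases i
  · simp [stdMap, ofOm, toOm]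
  · simp [stdMap, ofOm, toOm]
    ring

lemma stdMap_maps {ζ : ℂ} (hζ : ‖ζ‖ = 1) {δ : ℝ} (hδ : δ = 1 ∨ δ = -1) :
    MapsTo (stdMap ζ δ) (symEllipsoid (1 / 2) 2) (symEllipsoid (1 / 2) 2) := by
  intro z hz
  rw [mem_sym] at hz
  rw [stdMap, mem_sym_ofOm]
  generalize toOm z = w at hz
  have hw : (w.1, (δ : ℂ) * w.2) ∈ Om := by
    rcases hδ with rfl | rfl
    · simpa using hz
    · have h : ‖w.1‖ ^ 2 + ‖w.2 + w.1 ^ 2 / 2‖ + ‖w.2 - w.1 ^ 2 / 2‖ < 2 := hz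
      rw [Om_mem]
      have e1 : ((-1 : ℝ) : ℂ) * w.2 + w.1 ^ 2 / 2 = -(w.2 - w.1 ^ 2 / 2) := by push_cast; ring
      have e2 : ((-1 : ℝ) : ℂ) * w.2 - w.1 ^ 2 / 2 = -(w.2 + w.1 ^ 2 / 2) := by push_cast; ring
      rw [e1, e2, norm_neg, norm_neg]
      linarith
  exact Om_scale hw hζ.le

lemma stdMap_inv {ζ : ℂ} (hζ : ζ ≠ 0) {δ : ℝ} (hδ : δ = 1 ∨ δ = -1) (z : Fin 2 → ℂ) :
    stdMap ζ⁻¹ δ (stdMap ζ δ z) = z := by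
  have hd : (δ : ℂ) * δ = 1 := by
    rcases hδ with rfl | rfl <;> simp
  conv_rhs => rw [← ofOm_toOm z]
  rw [stdMap, stdMap, toOm_ofOm]
  congr 1
  apply Prod.ext
  · simp [hζ]
  · simp only
    field_simp
    linear_combination (toOm z).2 * hd

lemma stdMap_diff (ζ : ℂ) (δ : ℝ) : Differentiable ℂ (stdMap ζ δ) := by
  have h : Differentiable ℂ (fun w : ℂ × ℂ => (ζ * w.1, ζ ^ 2 * (δ * w.2))) := by fun_prop
  exact ofOm_diff.comp (h.comp toOm_diff)

lemma stdMap_aut {φ : (Fin 2 → ℂ) → (Fin 2 → ℂ)} {ζ : ℂ} (hζ : ‖ζ‖ = 1) {δ : ℝ}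
    (hδ : δ = 1 ∨ δ = -1) (h : ∀ z ∈ symEllipsoid (1 / 2) 2, φ z = stdMap ζ δ z) :
    IsAutomorphismOf φ (symEllipsoid (1 / 2) 2) := by
  have hζ0 : ζ ≠ 0 := by
    rintro rfl
    simp at hζ
  have hζ' : ‖ζ⁻¹‖ = 1 := by simp [hζ]
  have m1 : MapsTo φ (symEllipsoid (1 / 2) 2) (symEllipsoid (1 / 2) 2) :=
    (stdMap_maps hζ hδ).congr (fun z hz => (h z hz).symm)
  have m2 := stdMap_maps hζ' hδ
  have hi : InvOn (stdMap ζ⁻¹ δ) φ (symEllipsoid (1 / 2) 2) (symEllipsoid (1 / 2) 2) := by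
    constructor
    · intro z hz
      rw [h z hz, stdMap_inv hζ0 hδ]
    · intro z hz
      rw [h _ (m2 hz)]
      have := stdMap_inv (inv_ne_zero hζ0) hδ z
      rwa [inv_inv] at this
  exact ⟨(stdMap_diff ζ δ).differentiableOn.congr h, hi.bijOn m1 m2, _,
    (stdMap_diff ζ⁻¹ δ).differentiableOn, hi⟩

lemma aut_stdMap {φ : (Fin 2 → ℂ) → (Fin 2 → ℂ)}
    (h : IsAutomorphismOf φ (symEllipsoid (1 / 2) 2)) :
    ∃ ζ : ℂ, ‖ζ‖ = 1 ∧ ∃ δ : ℝ, (δ = 1 ∨ δ = -1) ∧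
      ∀ z ∈ symEllipsoid (1 / 2) 2, φ z = stdMap ζ δ z := by
  obtain ⟨hφ, hb, ψ, hψ, hi⟩ := h
  have mψ : MapsTo ψ (symEllipsoid (1 / 2) 2) (symEllipsoid (1 / 2) 2) := by
    intro z hz
    obtain ⟨w, hw, rfl⟩ := hb.surjOn hz
    rw [hi.1 hw]
    exact hw
  obtain ⟨ζ, hζ, δ, hδ, hf⟩ := (conj_pair hφ hψ hb.mapsTo mψ hi).form
  refine ⟨ζ, hζ, δ, hδ, fun z hz => ?_⟩
  have := hf (toOm z) ((mem_sym z).1 hz)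
  rw [ofOm_toOm] at this
  rw [stdMap, ← this, ofOm_toOm]


end Helpers

/-- The automorphisms of `𝔼_{1/2,2}` are exactly the maps
`(z₁,z₂) ↦ (ζz₁, ζ²z₂)` and `(z₁,z₂) ↦ (ζz₁, ζ²(z₁²/4 - z₂))` with `ζ ∈ 𝕋`. -/
theorem automorphisms_of_symEllipsoid_half_two (φ : (Fin 2 → ℂ) → (Fin 2 → ℂ)) :
    IsAutomorphismOf φ (symEllipsoid (1 / 2) 2) ↔
      ∃ ζ : ℂ, ‖ζ‖ = 1 ∧
        ((∀ z ∈ symEllipsoid (1 / 2) 2, φ z = ![ζ * z 0, ζ ^ 2 * z 1]) ∨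
         (∀ z ∈ symEllipsoid (1 / 2) 2,
            φ z = ![ζ * z 0, ζ ^ 2 * (z 0 ^ 2 / 4 - z 1)])) := by
  constructor
  · intro h
    obtain ⟨ζ, hζ, δ, hδ, hf⟩ := aut_stdMap h
    refine ⟨ζ, hζ, ?_⟩
    rcases hδ with rfl | rfl
    · left
      intro z hz
      rw [hf z hz, stdMap_one]
    · right
      intro z hz
      rw [hf z hz, stdMap_neg_one]
  · rintro ⟨ζ, hζ, h | h⟩
    · exact stdMap_aut hζ (Or.inl rfl) (fun z hz => by rw [h z hz, stdMap_one])
    · exact stdMap_aut hζ (Or.inr rfl) (fun z hz => by rw [h z hz, stdMap_neg_one])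
end

section
/- Let n ≥ 3, let m and l ≥ 2 be positive integers, and let φ = (φ₁,…,φ_n) be an automorphism of the unit ball 𝔹_n ⊂ ℂⁿ such that π_n(φ(z)^m) = π_n(φ(ξ z_σ)^m) for every z ∈ 𝔹_n, every permutation σ of {1,…,n} and every ξ = (ξ₁,…,ξ_n) ∈ 𝕋ⁿ with ξ_j^l = 1 (here φ(z)^m denotes the componentwise m-th power, ξz_σ := (ξ₁z_{σ(1)},…,ξ_n z_{σ(n)})). Then, up to a permutation of the variables and a permutation of the components, φ(z) = ζ(η₁z₁, …, η_n z_n) for some ζ, η₁, …, η_n ∈ 𝕋 with η_j^m = 1. -/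
open Finset

/-- Equal elementary symmetric functions force each value of one tuple to occur in the other. -/
lemma exists_eq_of_piMap_eq {n : ℕ} {v w : Fin n → ℂ} (h : piMap n v = piMap n w) (k : Fin n) :
    ∃ j, w k = v j := by
  classical
  have key : ∏ i, (Polynomial.X + Polynomial.C (v i)) =
      ∏ i, (Polynomial.X + Polynomial.C (w i)) := by
    have e : ∀ u : Fin n → ℂ, ∏ i, (Polynomial.X + Polynomial.C (u i)) =
        ((univ.val.map u).map fun r => Polynomial.X + Polynomial.C r).prod := by
      intro u
      rw [Multiset.map_map]; rfl
    rw [e, e, Multiset.prod_X_add_C_eq_sum_esymm, Multiset.prod_X_add_C_eq_sum_esymm]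
    simp only [Multiset.card_map]
    refine Finset.sum_congr rfl fun j hj => ?_
    rw [Finset.esymm_map_val, Finset.esymm_map_val]
    congr 2
    cases j with
    | zero => simp
    | succ j =>
      have hj' : j < n := by simpa using hj
      exact congrFun h ⟨j, hj'⟩
  have h2 := congrArg (Polynomial.eval (-(w k))) key
  rw [Polynomial.eval_prod, Polynomial.eval_prod] at h2
  simp only [Polynomial.eval_add, Polynomial.eval_X, Polynomial.eval_C] at h2
  rw [Finset.prod_eq_zero (i := k) (f := fun x => -w k + w x) (Finset.mem_univ k) (by simp),
    Finset.prod_eq_zero_iff] at h2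
  obtain ⟨j, -, hj⟩ := h2
  exact ⟨j, by linear_combination -hj⟩

/-- Cartan: an automorphism of a Hilbert ball fixing the origin is linear and isometric. -/
lemma cartan_ball {E : Type*} [NormedAddCommGroup E] [InnerProductSpace ℂ E]
    {F G : E → E} (hF : DifferentiableOn ℂ F (Metric.ball 0 1))
    (hG : DifferentiableOn ℂ G (Metric.ball 0 1))
    (mF : Set.MapsTo F (Metric.ball 0 1) (Metric.ball 0 1))
    (mG : Set.MapsTo G (Metric.ball 0 1) (Metric.ball 0 1))
    (hGF : ∀ x ∈ Metric.ball (0 : E) 1, G (F x) = x) (h0 : F 0 = 0)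
    {z : E} (hz : ‖z‖ < 1) : F z = fderiv ℂ F 0 z ∧ ‖F z‖ = ‖z‖ := by
  have hG0 : G 0 = 0 := by
    have := hGF 0 (by simp)
    rwa [h0] at this
  have hnorm : ‖F z‖ = ‖z‖ := by
    apply le_antisymm
    · exact Complex.norm_le_norm_of_mapsTo_ball hF
        (mF.mono_right Metric.ball_subset_closedBall) h0 hz
    · have hz' : z ∈ Metric.ball (0 : E) 1 := by simpa using hz
      have := Complex.norm_le_norm_of_mapsTo_ball hG
        (mG.mono_right Metric.ball_subset_closedBall) hG0 (z := F z) (by simpa using mF hz')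
      rwa [hGF z hz'] at this
  refine ⟨?_, hnorm⟩
  rcases eq_or_ne z 0 with rfl | hz0
  · simp [h0]
  have hzp : 0 < ‖z‖ := norm_pos_iff.mpr hz0
  let : NormedSpace ℝ E := NormedSpace.restrictScalars ℝ ℂ E
  have hm : Set.MapsTo (fun t : ℂ => t • z) (Metric.ball 0 (1 / ‖z‖)) (Metric.ball 0 1) := by
    intro t ht
    have ht' : ‖t‖ < 1 / ‖z‖ := by simpa using ht
    rw [lt_div_iff₀ hzp] at ht'
    simpa [norm_smul] using ht'
  have hsc : StrictConvexSpace ℝ E := by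
    let : InnerProductSpace ℝ E := InnerProductSpace.rclikeToReal ℂ E
    infer_instance
  have haff := Complex.affine_of_mapsTo_ball_of_norm_dslope_eq_div (f := fun t : ℂ => F (t • z))
    (c := 0) (R₁ := 1 / ‖z‖) (R₂ := 1) (z₀ := 1)
    (hF.comp (by fun_prop) hm)
    (by
      intro t ht
      have := mF (hm ht)
      simp only [zero_smul, h0]
      exact Metric.ball_subset_closedBall this)
    (by simpa using (one_lt_inv₀ hzp).mpr hz)
    (by
      rw [dslope_of_ne _ one_ne_zero]
      simp [slope_def_module, h0, hnorm])
  have hs : dslope (fun t : ℂ => F (t • z)) 0 1 = F z := by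
    rw [dslope_of_ne _ one_ne_zero]
    simp [slope_def_module, h0]
  rw [hs] at haff
  have hev : (fun t : ℂ => F (t • z)) =ᶠ[nhds 0] fun t => t • F z := by
    filter_upwards [Metric.ball_mem_nhds (0 : ℂ) (show (0 : ℝ) < 1 / ‖z‖ by positivity)] with t ht
    have := haff ht
    simpa [h0] using this
  have d1 : HasDerivAt (fun t : ℂ => F (t • z)) (F z) 0 := by
    have : HasDerivAt (fun t : ℂ => t • F z) ((1 : ℂ) • F z) 0 :=
      (hasDerivAt_id (0 : ℂ)).smul_const (F z)
    rw [one_smul] at this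
    exact this.congr_of_eventuallyEq hev
  have d2 : HasDerivAt (fun t : ℂ => F (t • z)) (fderiv ℂ F 0 z) 0 := by
    have hd : HasFDerivAt F (fderiv ℂ F 0) ((0 : ℂ) • z) := by
      rw [zero_smul]
      exact (hF.differentiableAt (Metric.ball_mem_nhds _ one_pos)).hasFDerivAt
    have h1 : HasDerivAt (fun t : ℂ => t • z) z 0 := by
      simpa using (hasDerivAt_id (0 : ℂ)).smul_const z
    exact hd.comp_hasDerivAt 0 h1
  exact d1.unique d2

open ComplexConjugate in
/-- Each row of the matrix has a single non-zero entry. -/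
lemma row_monomial {n : ℕ} (hn : 3 ≤ n) {l : ℕ} (hl : 2 ≤ l)
    {A : Fin n → Fin n → ℂ}
    (hA : ∀ k j, ∑ i, A k i * conj (A j i) = if k = j then 1 else 0)
    (hinv : ∀ (σ : Equiv.Perm (Fin n)) (ξ : Fin n → ℂ), (∀ j, ξ j ^ l = 1) → ∀ k,
      ∃ j η, η ≠ 0 ∧ ∀ i, A k i * ξ i = η * A j (σ i)) (k : Fin n) :
    ∃ p, A k p ≠ 0 ∧ ∀ i, i ≠ p → A k i = 0 := by
  classical
  have hkk : ∑ i, A k i * conj (A k i) = 1 := by simpa using hA k k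
  have hsum : ∑ i, ‖A k i‖ ^ 2 = 1 := by
    have : ((∑ i, ‖A k i‖ ^ 2 : ℝ) : ℂ) = 1 := by
      rw [← hkk]; push_cast
      exact Finset.sum_congr rfl fun i _ => (Complex.mul_conj' _).symm
    exact_mod_cast this
  have hprim := Complex.isPrimitiveRoot_exp l (by omega)
  set x := Complex.exp (2 * Real.pi * Complex.I / l) with hx
  have hxl : x ^ l = 1 := hprim.pow_eq_one
  have hx1 : x ≠ 1 := hprim.ne_one (by omega)
  have hxn : ‖x‖ = 1 := Complex.norm_eq_one_of_pow_eq_one hxl (by omega)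
  -- the trichotomy
  have tri : ∀ p, A k p ≠ 0 → (∀ i, i ≠ p → A k i = 0) ∨ ‖A k p‖ ^ 2 = 1 / 2 := by
    intro p hp
    obtain ⟨j, η, hη, h⟩ := hinv 1 (fun i => if i = p then x else 1)
      (by intro j; split_ifs <;> simp [hxl]) k
    simp only [Equiv.Perm.coe_one, id] at h
    by_cases hjk : j = k
    · left
      subst hjk
      have h1 := h p
      rw [if_pos rfl, mul_comm] at h1
      have hηx : x = η := mul_right_cancel₀ hp h1
      intro i hi
      have h2 := h i
      rw [if_neg hi, ← hηx] at h2
      have : (x - 1) * A j i = 0 := by linear_combination -h2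
      exact (mul_eq_zero.mp this).resolve_left (sub_ne_zero.mpr hx1)
    · right
      have h0 : ∑ i, A k i * (if i = p then x else 1) * conj (A k i) = 0 := by
        have : ∑ i, A k i * (if i = p then x else 1) * conj (A k i) =
            η * ∑ i, A j i * conj (A k i) := by
          rw [Finset.mul_sum]
          exact Finset.sum_congr rfl fun i _ => by rw [h i]; ring
        rw [this, hA j k, if_neg hjk, mul_zero]
      have h1 : ∑ i, A k i * (if i = p then x else 1) * conj (A k i) =
          1 + (x - 1) * (A k p * conj (A k p)) := by
        have e1 : ∑ i, (if i = p then (x - 1) * (A k i * conj (A k i)) else 0) =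
            (x - 1) * (A k p * conj (A k p)) := by simp
        refine Eq.trans ?_ (congrArg₂ (· + ·) hkk e1)
        rw [← Finset.sum_add_distrib]
        refine Finset.sum_congr rfl fun i _ => ?_
        split_ifs <;> ring
      rw [h1, Complex.mul_conj'] at h0
      set t := ‖A k p‖ ^ 2 with ht
      have htp : 0 < t := by positivity
      have h0' : 1 + (x - 1) * (t : ℂ) = 0 := by rw [ht]; push_cast; exact h0
      have htc : (t : ℂ) ≠ 0 := by exact_mod_cast htp.ne'
      have hx2 : x * t = ((t - 1 : ℝ) : ℂ) := by push_cast; linear_combination h0'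
      have h3 := congrArg norm hx2
      rw [norm_mul, hxn, Complex.norm_real, Complex.norm_real, Real.norm_eq_abs, Real.norm_eq_abs,
        one_mul, abs_of_pos htp] at h3
      rcases abs_cases (t - 1) with ⟨h4, _⟩ | ⟨h4, _⟩ <;> linarith
  obtain ⟨p, hp⟩ : ∃ p, A k p ≠ 0 := by
    by_contra! hcon
    simp [hcon] at hsum
  rcases tri p hp with h | hph
  · exact ⟨p, hp, h⟩
  by_contra hcon
  have : ∃ q, q ≠ p ∧ A k q ≠ 0 := by
    by_contra! hc
    exact hcon ⟨p, hp, hc⟩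
  obtain ⟨q, hqp, hq⟩ := this
  have hqh : ‖A k q‖ ^ 2 = 1 / 2 := (tri q hq).resolve_left fun h => hp (h p hqp.symm)
  obtain ⟨r, hr⟩ : ∃ r, r ∉ ({p, q} : Finset (Fin n)) := by
    by_contra! hc
    have h1 : (univ : Finset (Fin n)) ⊆ {p, q} := fun r _ => hc r
    have h2 := Finset.card_le_card h1
    have h3 := Finset.card_le_two (a := p) (b := q)
    rw [Finset.card_univ, Fintype.card_fin] at h2
    omega
  have hother : ∀ i, i ≠ p → i ≠ q → A k i = 0 := by
    intro i hip hiq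
    have h1 : ∑ j ∈ ({p, q, i} : Finset (Fin n)), ‖A k j‖ ^ 2 ≤ 1 := by
      rw [← hsum]
      exact Finset.sum_le_sum_of_subset_of_nonneg (Finset.subset_univ _) fun _ _ _ => by positivity
    rw [Finset.sum_insert (by simp [hqp.symm, hip.symm]), Finset.sum_insert (by simp [hiq.symm]),
      Finset.sum_singleton, hph, hqh] at h1
    have h2 : ‖A k i‖ ^ 2 = 0 := le_antisymm (by linarith) (by positivity)
    simpa using h2
  simp only [Finset.mem_insert, Finset.mem_singleton, not_or] at hr
  have hr0 := hother r hr.1 hr.2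
  obtain ⟨j, η, hη, h⟩ := hinv (Equiv.swap q r) (fun _ => 1) (by simp) k
  simp only [mul_one] at h
  by_cases hjk : j = k
  · subst hjk
    have := h q
    rw [Equiv.swap_apply_left, hr0, mul_zero] at this
    exact hq this
  · have h0 : ∑ i, A k (Equiv.swap q r i) * conj (A k i) = 0 := by
      have : ∑ i, A k (Equiv.swap q r i) * conj (A k i) = η * ∑ i, A j i * conj (A k i) := by
        rw [Finset.mul_sum]
        refine Finset.sum_congr rfl fun i _ => ?_
        rw [h, Equiv.swap_apply_self]; ring
      rw [this, hA j k, if_neg hjk, mul_zero]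
    rw [Finset.sum_eq_single p] at h0
    · rw [Equiv.swap_apply_of_ne_of_ne hqp.symm (Ne.symm hr.1)] at h0
      simp [hp] at h0
    · intro i _ hip
      by_cases hiq : i = q
      · rw [hiq, Equiv.swap_apply_left, hr0, zero_mul]
      · rw [hother i hip hiq]; simp
    · simp

open ComplexConjugate in
/-- The algebraic part: the matrix is a scalar times a monomial matrix with roots of unity. -/
lemma matrix_monomial {n : ℕ} (hn : 3 ≤ n) {m l : ℕ} (hm : 0 < m) (hl : 2 ≤ l)
    {A : Fin n → Fin n → ℂ}
    (hA : ∀ k j, ∑ i, A k i * conj (A j i) = if k = j then 1 else 0)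
    (hinv : ∀ (σ : Equiv.Perm (Fin n)) (ξ : Fin n → ℂ), (∀ j, ξ j ^ l = 1) → ∀ k,
      ∃ j η, η ^ m = 1 ∧ ∀ i, A k i * ξ i = η * A j (σ i)) :
    ∃ (σ : Equiv.Perm (Fin n)) (ζ : ℂ) (η : Fin n → ℂ),
      ‖ζ‖ = 1 ∧ (∀ j, ‖η j‖ = 1 ∧ η j ^ m = 1) ∧
      ∀ k i, A k i = if i = σ k then ζ * η k else 0 := by
  classical
  have hrow := row_monomial hn hl hA (fun σ ξ hξ k => by
    obtain ⟨j, η, hη, h⟩ := hinv σ ξ hξ k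
    refine ⟨j, η, ?_, h⟩
    rintro rfl
    simp [zero_pow hm.ne'] at hη)
  choose s hs hs0 using hrow
  have hinj : Function.Injective s := by
    intro a b hab
    by_contra hne
    have h := hA a b
    rw [if_neg hne, Finset.sum_eq_single (s a)] at h
    · have h1 := hs a
      have h2 := hs b
      rw [← hab] at h2
      simp [h1, h2] at h
    · intro i _ hi
      rw [hs0 a i hi, zero_mul]
    · simp
  have hnorm : ∀ k, ‖A k (s k)‖ = 1 := by
    intro k
    have h := hA k k
    rw [if_pos rfl, Finset.sum_eq_single (s k)] at h
    · rw [Complex.mul_conj'] at h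
      have h' : ‖A k (s k)‖ ^ 2 = 1 := by exact_mod_cast h
      exact (pow_eq_one_iff_of_nonneg (norm_nonneg _) two_ne_zero).mp h'
    · intro i _ hi
      rw [hs0 k i hi, zero_mul]
    · simp
  let k0 : Fin n := ⟨0, by omega⟩
  have hη : ∀ k, ∃ η : ℂ, η ^ m = 1 ∧ A k (s k) = A k0 (s k0) * η := by
    intro k
    obtain ⟨j, η, h1, h⟩ := hinv (Equiv.swap (s k) (s k0)) (fun _ => 1) (by simp) k
    have h2 := h (s k)
    rw [Equiv.swap_apply_left, mul_one] at h2
    have hj : s j = s k0 := by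
      by_contra hne
      rw [hs0 j _ (Ne.symm hne), mul_zero] at h2
      exact hs k h2
    have := hinj hj
    subst this
    exact ⟨η, h1, by rw [h2, mul_comm]⟩
  choose η hη1 hη2 using hη
  refine ⟨Equiv.ofBijective s (Finite.injective_iff_bijective.mp hinj), A k0 (s k0), η, hnorm k0,
    fun j => ⟨Complex.norm_eq_one_of_pow_eq_one (hη1 j) hm.ne', hη1 j⟩, ?_⟩
  intro k i
  simp only [Equiv.ofBijective_apply]
  split_ifs with h
  · rw [h, hη2]
  · exact hs0 k i h

lemma mem_unitBall_iff {n : ℕ} (z : Fin n → ℂ) :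
    z ∈ unitBall n ↔ ‖(WithLp.toLp 2 z : EuclideanSpace ℂ (Fin n))‖ < 1 := by
  rw [← sq_lt_one_iff₀ (norm_nonneg _), EuclideanSpace.norm_sq_eq]
  rfl

open ComplexConjugate in
/-- An automorphism of the ball fixing the origin is given by a unitary matrix. -/
lemma exists_matrix {n : ℕ} {φ : (Fin n → ℂ) → (Fin n → ℂ)}
    (hφ : IsAutomorphismOf φ (unitBall n)) (h0 : φ 0 = 0) :
    ∃ A : Fin n → Fin n → ℂ,
      (∀ k j, ∑ i, A k i * conj (A j i) = if k = j then 1 else 0) ∧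
      ∀ z ∈ unitBall n, ∀ k, φ z k = ∑ i, A k i * z i := by
  classical
  obtain ⟨hd, hbij, ψ, hψ, hinv⟩ := hφ
  let F : EuclideanSpace ℂ (Fin n) → EuclideanSpace ℂ (Fin n) := fun x => WithLp.toLp 2 (φ (WithLp.ofLp x))
  let G : EuclideanSpace ℂ (Fin n) → EuclideanSpace ℂ (Fin n) := fun x => WithLp.toLp 2 (ψ (WithLp.ofLp x))
  have mO : Set.MapsTo (fun x : EuclideanSpace ℂ (Fin n) => WithLp.ofLp x) (Metric.ball 0 1) (unitBall n) := by
    intro x hx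
    rw [mem_unitBall_iff]
    simpa using hx
  have mT : Set.MapsTo (fun x : Fin n → ℂ => (WithLp.toLp 2 x : EuclideanSpace ℂ (Fin n))) (unitBall n)
      (Metric.ball 0 1) := by
    intro x hx
    rw [mem_unitBall_iff] at hx
    simpa using hx
  have dO : Differentiable ℂ (fun x : EuclideanSpace ℂ (Fin n) => WithLp.ofLp x) :=
    (PiLp.continuousLinearEquiv 2 ℂ (fun _ : Fin n => ℂ)).differentiable
  have dT : Differentiable ℂ (fun x : Fin n → ℂ => (WithLp.toLp 2 x : EuclideanSpace ℂ (Fin n))) :=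
    (PiLp.continuousLinearEquiv 2 ℂ (fun _ : Fin n => ℂ)).symm.differentiable
  have mψ : Set.MapsTo ψ (unitBall n) (unitBall n) := by
    intro y hy
    obtain ⟨x, hx, rfl⟩ := hbij.surjOn hy
    rw [hinv.1 hx]; exact hx
  have cart := fun z hz => cartan_ball (F := F) (G := G)
    (dT.comp_differentiableOn (hd.comp dO.differentiableOn mO))
    (dT.comp_differentiableOn (hψ.comp dO.differentiableOn mO))
    (fun x hx => mT (hbij.mapsTo (mO hx))) (fun x hx => mT (mψ (mO hx)))
    (fun x hx => by
      change WithLp.toLp 2 (ψ (φ (WithLp.ofLp x))) = x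
      rw [hinv.1 (mO hx)]) (by
      change WithLp.toLp 2 (φ (WithLp.ofLp (0 : EuclideanSpace ℂ (Fin n)))) = 0
      rw [WithLp.ofLp_zero, h0, WithLp.toLp_zero]) (z := z) hz
  set L : EuclideanSpace ℂ (Fin n) →L[ℂ] EuclideanSpace ℂ (Fin n) := fderiv ℂ F 0 with hL
  have hiso : ∀ x, ‖L x‖ = ‖x‖ := by
    intro x
    rcases eq_or_ne x 0 with rfl | hx
    · simp
    have hxp : 0 < ‖x‖ := norm_pos_iff.mpr hx
    let c : ℂ := ((2 * ‖x‖ : ℝ) : ℂ)⁻¹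
    have hcn : ‖c‖ = (2 * ‖x‖)⁻¹ := by
      simp only [c]
      rw [norm_inv, Complex.norm_real, Real.norm_of_nonneg (by positivity)]
    have hc0 : 0 < ‖c‖ := by rw [hcn]; positivity
    have hcx : ‖c • x‖ < 1 := by
      rw [norm_smul, hcn, mul_inv, mul_assoc, inv_mul_cancel₀ hxp.ne']; norm_num
    obtain ⟨h1, h2⟩ := cart (c • x) hcx
    rw [h1, map_smul, norm_smul, norm_smul] at h2
    exact mul_left_cancel₀ hc0.ne' h2
  let Li : EuclideanSpace ℂ (Fin n) →ₗᵢ[ℂ] EuclideanSpace ℂ (Fin n) := ⟨L.toLinearMap, hiso⟩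
  let M : Matrix (Fin n) (Fin n) ℂ := fun k i => L (EuclideanSpace.single i 1) k
  have hMM : M.conjTranspose * M = 1 := by
    ext i j
    have h1 := Li.inner_map_map (EuclideanSpace.single i (1 : ℂ)) (EuclideanSpace.single j (1 : ℂ))
    rw [Matrix.mul_apply, Matrix.one_apply]
    rw [EuclideanSpace.inner_single_left] at h1
    simp only [map_one, one_mul, PiLp.inner_apply] at h1
    rw [PiLp.single_apply] at h1
    rw [← h1]
    refine Finset.sum_congr rfl fun k _ => ?_
    rw [Matrix.conjTranspose_apply, RCLike.inner_apply, mul_comm]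
    rfl
  have hMM' := mul_eq_one_comm.mp hMM
  refine ⟨M, ?_, ?_⟩
  · intro k j
    have := congrFun (congrFun hMM' k) j
    rw [Matrix.mul_apply, Matrix.one_apply] at this
    rw [← this]
    rfl
  · intro z hz k
    obtain ⟨h1, -⟩ := cart (WithLp.toLp 2 z) ((mem_unitBall_iff z).mp hz)
    have h2 : φ z k = L (WithLp.toLp 2 z) k := by
      rw [← h1]
    have h3 : (WithLp.toLp 2 z : EuclideanSpace ℂ (Fin n)) = ∑ i, z i • EuclideanSpace.single i (1 : ℂ) := by
      ext j
      simp [Pi.single_apply]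
    rw [h2, h3, map_sum]
    simp only [map_smul, WithLp.ofLp_sum, Finset.sum_apply]
    refine Finset.sum_congr rfl fun i _ => ?_
    simp [M, mul_comm]

/-- For `n ≥ 3` and `l ≥ 2`, an automorphism `φ` of `𝔹_n` with
`π_n(φ(z)^m) = π_n(φ(ξ z_σ)^m)` for all permutations `σ` and all `l`-th roots of
unity `ξ_j` is, up to permutations of the variables and of the components, a
rotation `φ(z) = ζ(η₁z₁, …, η_nz_n)` with `η_j^m = 1`. -/
theorem ball_automorphism_invariant_is_rotation (n : ℕ) (hn : 3 ≤ n)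
    (m l : ℕ) (hm : 0 < m) (hl : 2 ≤ l)
    (φ : (Fin n → ℂ) → (Fin n → ℂ)) (hφ : IsAutomorphismOf φ (unitBall n))
    (hsym : ∀ (σ : Equiv.Perm (Fin n)) (ξ : Fin n → ℂ), (∀ j, ξ j ^ l = 1) →
      ∀ z ∈ unitBall n,
        piMap n (fun k => φ z k ^ m) =
          piMap n (fun k => φ (fun i => ξ i * z (σ i)) k ^ m)) :
    ∃ (σ τ : Equiv.Perm (Fin n)) (ζ : ℂ) (η : Fin n → ℂ),
      ‖ζ‖ = 1 ∧ (∀ j, ‖η j‖ = 1 ∧ η j ^ m = 1) ∧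
      ∀ z ∈ unitBall n, ∀ j : Fin n, φ z (τ j) = ζ * η j * z (σ j) := by
  classical
  -- group action preserves the ball
  have hball : ∀ (σ : Equiv.Perm (Fin n)) (ξ : Fin n → ℂ), (∀ j, ξ j ^ l = 1) →
      ∀ z ∈ unitBall n, (fun i => ξ i * z (σ i)) ∈ unitBall n := by
    intro σ ξ hξ z hz
    have hz' : ∑ j, ‖z j‖ ^ 2 < 1 := hz
    change ∑ i, ‖ξ i * z (σ i)‖ ^ 2 < 1
    rw [← Equiv.sum_comp σ] at hz'
    refine lt_of_eq_of_lt (Finset.sum_congr rfl fun i _ => ?_) hz'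
    rw [norm_mul, Complex.norm_eq_one_of_pow_eq_one (hξ i) (by omega), one_mul]
  have hzero : (0 : Fin n → ℂ) ∈ unitBall n := by
    change ∑ j, ‖(0 : Fin n → ℂ) j‖ ^ 2 < 1
    simp
  -- the origin is fixed
  have h0 : φ 0 = 0 := by
    obtain ⟨w, hw, hφw⟩ := hφ.2.1.surjOn hzero
    have hprim := Complex.isPrimitiveRoot_exp l (by omega)
    set x := Complex.exp (2 * Real.pi * Complex.I / l) with hx
    have hxl : x ^ l = 1 := hprim.pow_eq_one
    have hx1 : x ≠ 1 := hprim.ne_one (by omega)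
    have hs := hsym 1 (fun _ => x) (fun _ => hxl) w hw
    have hw' := hball 1 (fun _ => x) (fun _ => hxl) w hw
    have hz : φ (fun i => x * w ((1 : Equiv.Perm (Fin n)) i)) = 0 := by
      ext k
      obtain ⟨j, hj⟩ := exists_eq_of_piMap_eq hs k
      rw [hφw, Pi.zero_apply, zero_pow hm.ne'] at hj
      simpa using (pow_eq_zero_iff hm.ne').mp hj
    have heq := hφ.2.1.injOn hw' hw (hz.trans hφw.symm)
    have hw0 : w = 0 := by
      ext i
      have h1 := congrFun heq i
      simp only [Equiv.Perm.coe_one, id] at h1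
      have : (x - 1) * w i = 0 := by linear_combination h1
      exact (mul_eq_zero.mp this).resolve_left (sub_ne_zero.mpr hx1)
    rw [← hw0]
    rw [hφw, hw0]
  obtain ⟨A, hA, hAφ⟩ := exists_matrix hφ h0
  have hinv : ∀ (σ : Equiv.Perm (Fin n)) (ξ : Fin n → ℂ), (∀ j, ξ j ^ l = 1) → ∀ k,
      ∃ j η, η ^ m = 1 ∧ ∀ i, A k i * ξ i = η * A j (σ i) := by
    intro σ ξ hξ k
    have : NeZero m := ⟨hm.ne'⟩
    let f : Fin n × rootsOfUnity m ℂ → ((Fin n → ℂ) →ₗ[ℂ] ℂ) := fun q =>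
      ∑ i, (A k i * ξ i - ((q.2 : ℂˣ) : ℂ) * A q.1 (σ i)) • LinearMap.proj (σ i)
    have hf : ∀ q z, f q z = ∑ i, A k i * (ξ i * z (σ i)) -
        ((q.2 : ℂˣ) : ℂ) * ∑ i, A q.1 i * z i := by
      intro q z
      rw [← Equiv.sum_comp σ (fun i => A q.1 i * z i), Finset.mul_sum, ← Finset.sum_sub_distrib]
      simp only [f, LinearMap.sum_apply, LinearMap.smul_apply, LinearMap.proj_apply, smul_eq_mul]
      exact Finset.sum_congr rfl fun i _ => by ring
    have hcov : ⋃ q, ((LinearMap.ker (f q) : Submodule ℂ (Fin n → ℂ)) : Set (Fin n → ℂ)) =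
        Set.univ := by
      -- first inside the ball
      have hin : ∀ z ∈ unitBall n, ∃ q, f q z = 0 := by
        intro z hz
        obtain ⟨j, hj⟩ := exists_eq_of_piMap_eq (hsym σ ξ hξ z hz) k
        rw [hAφ _ (hball σ ξ hξ z hz), hAφ z hz] at hj
        set a := ∑ i, A k i * (ξ i * z (σ i)) with ha
        set b := ∑ i, A j i * z i with hb
        by_cases hb0 : b = 0
        · refine ⟨(j, 1), ?_⟩
          rw [hf, ← ha, ← hb, hb0]
          rw [hb0, zero_pow hm.ne'] at hj
          simp [(pow_eq_zero_iff hm.ne').mp hj]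
        · have hr : (a / b) ^ m = 1 := by
            rw [div_pow, hj, div_self (pow_ne_zero _ hb0)]
          refine ⟨(j, rootsOfUnity.mkOfPowEq (a / b) hr), ?_⟩
          rw [hf, ← ha, ← hb]
          simp [div_mul_cancel₀ _ hb0]
      rw [Set.eq_univ_iff_forall]
      intro z
      rw [Set.mem_iUnion]
      let N : ℝ := ∑ j, ‖z j‖ ^ 2
      have hN : 0 ≤ N := Finset.sum_nonneg fun _ _ => by positivity
      let c : ℂ := ((1 + N : ℝ) : ℂ)⁻¹
      have hc0 : c ≠ 0 := by
        refine inv_ne_zero ?_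
        exact_mod_cast (by positivity : (1 + N : ℝ) ≠ 0)
      have hcn : ‖c‖ = (1 + N)⁻¹ := by
        simp only [c]
        rw [norm_inv, Complex.norm_real, Real.norm_of_nonneg (by positivity)]
      have hcz : c • z ∈ unitBall n := by
        change ∑ j, ‖(c • z) j‖ ^ 2 < 1
        have : ∑ j, ‖(c • z) j‖ ^ 2 = ((1 + N)⁻¹) ^ 2 * N := by
          simp only [N]
          rw [Finset.mul_sum]
          refine Finset.sum_congr rfl fun j _ => ?_
          rw [Pi.smul_apply, norm_smul, mul_pow, hcn]
        rw [this, inv_pow, inv_mul_lt_iff₀ (by positivity)]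
        nlinarith
      obtain ⟨q, hq⟩ := hin _ hcz
      refine ⟨q, ?_⟩
      rw [map_smul, smul_eq_mul] at hq
      exact (mul_eq_zero.mp hq).resolve_left hc0
    obtain ⟨q, hq⟩ := Subspace.exists_eq_top_of_iUnion_eq_univ hcov
    refine ⟨q.1, ((q.2 : ℂˣ) : ℂ), ?_, ?_⟩
    · have h1 := (mem_rootsOfUnity' m _).mp q.2.2
      exact h1
    · intro i
      have h1 : f q (Pi.single (σ i) 1) = 0 := by
        rw [← LinearMap.mem_ker, hq]; trivial
      simp only [f, LinearMap.sum_apply, LinearMap.smul_apply, LinearMap.proj_apply,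
        smul_eq_mul] at h1
      rw [Finset.sum_eq_single i] at h1
      · simpa [sub_eq_zero] using h1
      · intro j _ hj
        simp [hj]
      · simp
  obtain ⟨σ, ζ, η, hζ, hη, hform⟩ := matrix_monomial hn hm hl hA hinv
  refine ⟨σ, 1, ζ, η, hζ, hη, ?_⟩
  intro z hz j
  rw [Equiv.Perm.coe_one, id, hAφ z hz]
  simp [hform]
end
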